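/- Let (Y,θ) be a generating system of n nondegenerate regular A-correspondences and let 1 < k ≤ n. For any j = 1,…,n, the O(Y_k ⊗_A O(Y_1∗⋯∗Y_{k-1}))-correspondence (Y_j ⊗_A O(Y_1∗⋯∗Y_{k-1})) ⊗_{O(Y_1∗⋯∗Y_{k-1})} O(Y_k ⊗_A O(Y_1∗⋯∗Y_{k-1})) and the O(Y_1∗⋯∗Y_k)-correspondence Y_j ⊗_A O(Y_1∗⋯∗Y_k) are isomorphic; the isomorphism of bimodules is φ : (x ⊗ S) ⊗ T ↦ x ⊗ ι^{-1}(ST), compatible with the isomorphism ι : O(Y_1∗⋯∗Y_k) → O(Y_k ⊗_A O(Y_1∗⋯∗Y_{k-1})). -/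

import Mathlib

/- ############################################################
   Common framework: C*-correspondences, interior tensor products
   (characterized relationally), representations, Cuntz–Pimsner algebras,
   product systems over ℕ^k, generating systems, and the ℰ / ℛθ
   constructions of the paper (characterized relationally).
   ############################################################ -/

noncomputable section

open Filter Topology

universe u

/-- A C*-correspondence over a (not necessarily unital) C*-algebra `A`:
a right Hilbert `A`-module `X` together with a left action of `A` by
adjointable (bounded) operators.  The rank-one operators `θ_{x,y}` are
bundled as data together with their defining property. -/
structure Corr (A : Type u) [NonUnitalCStarAlgebra A] : Type (u + 1) where
  X : Type u
  [nacg : NormedAddCommGroup X]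
  [nsp : NormedSpace ℂ X]
  [cmpl : CompleteSpace X]
  /-- right action of `A` -/
  ract : X → A → X
  /-- `A`-valued inner product -/
  inner : X → X → A
  /-- left action `φ : A → L(X)` by adjointable operators -/
  lactL : A → X →L[ℂ] X
  /-- the rank-one ("compact") operators `θ_{x,y} z = x ⬝ ⟨y, z⟩` -/
  rankOne : X → X → X →L[ℂ] X
  ract_add_left : ∀ x y a, ract (x + y) a = ract x a + ract y a
  ract_add_right : ∀ x a b, ract x (a + b) = ract x a + ract x b
  ract_mul : ∀ x a b, ract x (a * b) = ract (ract x a) b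
  ract_smul : ∀ (c : ℂ) x a, ract (c • x) a = c • ract x a
  ract_smul' : ∀ (c : ℂ) x a, ract x (c • a) = c • ract x a
  inner_add_right : ∀ x y z, inner x (y + z) = inner x y + inner x z
  inner_smul_right : ∀ (c : ℂ) x y, inner x (c • y) = c • inner x y
  inner_star : ∀ x y, star (inner x y) = inner y x
  inner_ract_right : ∀ x y a, inner x (ract y a) = inner x y * a
  norm_eq : ∀ x, ‖x‖ ^ 2 = ‖inner x x‖
  lact_add : ∀ a b, lactL (a + b) = lactL a + lactL b
  lact_mul : ∀ a b, lactL (a * b) = (lactL a).comp (lactL b)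
  lact_smul : ∀ (c : ℂ) a, lactL (c • a) = c • lactL a
  lact_adjoint : ∀ a x y, inner (lactL a x) y = inner x (lactL (star a) y)
  rankOne_apply : ∀ x y z, rankOne x y z = ract x (inner y z)

attribute [instance] Corr.nacg Corr.nsp Corr.cmpl

variable {A : Type u} [NonUnitalCStarAlgebra A]

/-- Nondegeneracy: `A·X` is (topologically) all of `X`. -/
def Corr.Nondeg (W : Corr A) : Prop :=
  closure (Submodule.span ℂ {y : W.X | ∃ a x, y = W.lactL a x} : Set W.X) = Set.univ

/-- Regularity: the left action is injective and takes values in the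
compact operators (the closed span of the rank-one operators). -/
def Corr.Regular (W : Corr A) : Prop :=
  (∀ a, W.lactL a = 0 → a = 0) ∧
    ∀ a, W.lactL a ∈
      closure (Submodule.span ℂ {T : W.X →L[ℂ] W.X | ∃ x y, T = W.rankOne x y} :
        Set (W.X →L[ℂ] W.X))

/-- standing hypotheses of the paper: nondegenerate and regular -/
def Corr.Reg (W : Corr A) : Prop := W.Nondeg ∧ W.Regular

/-- a bare function which is a continuous `ℂ`-linear map -/
structure IsCLMap {E F : Type u} [NormedAddCommGroup E] [NormedSpace ℂ E]
    [NormedAddCommGroup F] [NormedSpace ℂ F] (f : E → F) : Prop where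
  map_add : ∀ x y, f (x + y) = f x + f y
  map_smul : ∀ (c : ℂ) x, f (c • x) = c • f x
  cont : Continuous f

/-- a map of correspondences over the same algebra which is an isomorphism -/
structure IsCorrIsoFun (W Z : Corr A) (f : W.X → Z.X) : Prop where
  bijective : Function.Bijective f
  map_add : ∀ x y, f (x + y) = f x + f y
  map_smul : ∀ (c : ℂ) x, f (c • x) = c • f x
  map_inner : ∀ x y, Z.inner (f x) (f y) = W.inner x y
  map_ract : ∀ x a, f (W.ract x a) = Z.ract (f x) a
  map_lact : ∀ a x, f (W.lactL a x) = Z.lactL a (f x)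

/-- an isomorphism of correspondences over the same algebra (bundled) -/
structure CorrIso (W Z : Corr A) : Type u where
  toFun : W.X → Z.X
  invFun : Z.X → W.X
  left_inv : ∀ x, invFun (toFun x) = x
  right_inv : ∀ y, toFun (invFun y) = y
  map_add : ∀ x y, toFun (x + y) = toFun x + toFun y
  map_smul : ∀ (c : ℂ) x, toFun (c • x) = c • toFun x
  map_inner : ∀ x y, Z.inner (toFun x) (toFun y) = W.inner x y
  map_ract : ∀ x a, toFun (W.ract x a) = Z.ract (toFun x) a
  map_lact : ∀ a x, toFun (W.lactL a x) = Z.lactL a (toFun x)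

/-- an isomorphism of correspondences lying over an isomorphism `Φ` of the
coefficient algebras -/
structure CorrIsoOver {B : Type u} [NonUnitalCStarAlgebra B]
    (Φ : A → B) (W : Corr A) (Z : Corr B) : Type u where
  toFun : W.X → Z.X
  bijective : Function.Bijective toFun
  map_add : ∀ x y, toFun (x + y) = toFun x + toFun y
  map_smul : ∀ (c : ℂ) x, toFun (c • x) = c • toFun x
  map_inner : ∀ x y, Z.inner (toFun x) (toFun y) = Φ (W.inner x y)
  map_ract : ∀ x a, toFun (W.ract x a) = Z.ract (toFun x) (Φ a)
  map_lact : ∀ a x, toFun (W.lactL a x) = Z.lactL (Φ a) (toFun x)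

/-- `T`, together with the bilinear map `m`, is a realization of the
balanced (interior) tensor product `W ⊗_A V` of correspondences over `A`. -/
structure IsTensor (W V T : Corr A) (m : W.X → V.X → T.X) : Prop where
  add_left : ∀ x x' y, m (x + x') y = m x y + m x' y
  add_right : ∀ x y y', m x (y + y') = m x y + m x y'
  smul_left : ∀ (c : ℂ) x y, m (c • x) y = c • m x y
  smul_right : ∀ (c : ℂ) x y, m x (c • y) = c • m x y
  balanced : ∀ x a y, m (W.ract x a) y = m x (V.lactL a y)
  inner : ∀ x y x' y',
    T.inner (m x y) (m x' y') = V.inner y (V.lactL (W.inner x x') y')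
  ract : ∀ x y a, T.ract (m x y) a = m x (V.ract y a)
  lact : ∀ a x y, T.lactL a (m x y) = m (W.lactL a x) y
  dense : closure (Submodule.span ℂ {z : T.X | ∃ x y, z = m x y} : Set T.X) = Set.univ

variable {B : Type u} [NonUnitalCStarAlgebra B]

/-- `π : A → B` is a *-homomorphism (stated elementwise) -/
structure IsStarHom (π : A → B) : Prop where
  map_add : ∀ a b, π (a + b) = π a + π b
  map_mul : ∀ a b, π (a * b) = π a * π b
  map_star : ∀ a, π (star a) = star (π a)
  map_smul : ∀ (c : ℂ) a, π (c • a) = c • π a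

/-- `(π, t)` is a representation (Toeplitz representation) of the
correspondence `W` in the C*-algebra `B`. -/
structure IsRep (W : Corr A) (π : A → B) (t : W.X → B) : Prop where
  hom : IsStarHom π
  t_add : ∀ x y, t (x + y) = t x + t y
  t_smul : ∀ (c : ℂ) x, t (c • x) = c • t x
  lact : ∀ a x, t (W.lactL a x) = π a * t x
  ract : ∀ x a, t (W.ract x a) = t x * π a
  inner : ∀ x y, star (t x) * t y = π (W.inner x y)

/-- Cuntz–Pimsner covariance of a representation of a *regular*
correspondence: whenever `φ(a)` is approximated in norm by finite sums of
rank-one operators `θ_{x,y}`, `π(a)` is approximated by the corresponding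
sums `t(x) t(y)*`.  (For regular correspondences this is equivalent to
`π = t⁽¹⁾ ∘ φ`.) -/
def CPCov (W : Corr A) (π : A → B) (t : W.X → B) : Prop :=
  ∀ (a : A) (N : ℕ → ℕ) (x y : ∀ n, Fin (N n) → W.X),
    Tendsto (fun n => ∑ r, W.rankOne (x n r) (y n r)) atTop (𝓝 (W.lactL a)) →
    Tendsto (fun n => ∑ r, t (x n r) * star (t (y n r))) atTop (𝓝 (π a))

/-- The Cuntz–Pimsner algebra of a correspondence `W`: a C*-algebra `O`
together with a universal covariant representation `(π, t)`:  `(π,t)` is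
covariant, `π` is injective, `O` is generated by the images of `π` and `t`,
and every covariant representation factors uniquely through `O`. -/
structure CPAlg (W : Corr A) : Type (u + 1) where
  O : Type u
  [alg : NonUnitalCStarAlgebra O]
  π : A → O
  t : W.X → O
  isRep : IsRep W π t
  covariant : CPCov W π t
  inj : Function.Injective π
  gen : ∀ S : Set O, IsClosed S →
    (∀ a, π a ∈ S) → (∀ x, t x ∈ S) →
    (∀ p q, p ∈ S → q ∈ S → p + q ∈ S) →
    (∀ p q, p ∈ S → q ∈ S → p * q ∈ S) →
    (∀ (c : ℂ) p, p ∈ S → c • p ∈ S) →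
    (∀ p, p ∈ S → star p ∈ S) → ∀ z, z ∈ S
  universal : ∀ (C : Type u) [NonUnitalCStarAlgebra C],
    ∀ (π' : A → C) (t' : W.X → C), IsRep W π' t' → CPCov W π' t' →
      ∃! h : O →⋆ₙₐ[ℂ] C, (∀ a, h (π a) = π' a) ∧ ∀ x, h (t x) = t' x

attribute [instance] CPAlg.alg

/- ##################  product systems over ℕ^k  ################## -/

/-- the `i`-th standard generator of `ℕ^k` -/
def egen {k : ℕ} (i : Fin k) : Fin k → ℕ := Pi.single i 1

/-- A product system over `ℕ^k` of (nondegenerate regular) correspondences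
over `A`:  fibers `fib s`, an associative multiplication implementing
isomorphisms `fib s ⊗_A fib t ≅ fib (s+t)`, and `fib 0 = A` (witnessed by
the unit map). -/
structure PSys (A : Type u) [NonUnitalCStarAlgebra A] (k : ℕ) : Type (u + 1) where
  fib : (Fin k → ℕ) → Corr A
  reg : ∀ s, (fib s).Reg
  mul : ∀ s t, (fib s).X → (fib t).X → (fib (s + t)).X
  isTensor : ∀ s t, IsTensor (fib s) (fib t) (fib (s + t)) (mul s t)
  assoc : ∀ s t u x y z,
    HEq (mul (s + t) u (mul s t x y) z) (mul s (t + u) x (mul t u y z))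
  unit : A → (fib 0).X
  unit_bij : Function.Bijective unit
  unit_add : ∀ a b, unit (a + b) = unit a + unit b
  unit_smul : ∀ (c : ℂ) a, unit (c • a) = c • unit a
  unit_inner : ∀ a b, (fib 0).inner (unit a) (unit b) = star a * b
  unit_lact : ∀ a b, (fib 0).lactL a (unit b) = unit (a * b)
  unit_ract : ∀ a b, (fib 0).ract (unit a) b = unit (a * b)
  unit_mul_left : ∀ s a x, HEq (mul 0 s (unit a) x) ((fib s).lactL a x)
  unit_mul_right : ∀ s x a, HEq (mul s 0 x (unit a)) ((fib s).ract x a)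

/-- a representation of a product system in a C*-algebra `B` -/
structure PSRep {k : ℕ} (Xs : PSys A k) (B : Type u) [NonUnitalCStarAlgebra B] :
    Type u where
  π : A → B
  ψ : ∀ s, (Xs.fib s).X → B
  isRep : ∀ s, IsRep (Xs.fib s) π (ψ s)
  ψ_zero : ∀ a, ψ 0 (Xs.unit a) = π a
  mul : ∀ s t x y, ψ s x * ψ t y = ψ (s + t) (Xs.mul s t x y)

/-- Cuntz–Pimsner covariance of a representation of a product system -/
def PSCPCov {k : ℕ} {Xs : PSys A k} {B : Type u} [NonUnitalCStarAlgebra B]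
    (r : PSRep Xs B) : Prop :=
  ∀ s, CPCov (Xs.fib s) r.π (r.ψ s)

/-- The Cuntz–Pimsner algebra `𝒪(X)` of a product system. -/
structure PSCPAlg {k : ℕ} (Xs : PSys A k) : Type (u + 1) where
  O : Type u
  [alg : NonUnitalCStarAlgebra O]
  rep : PSRep Xs O
  covariant : PSCPCov rep
  inj : Function.Injective rep.π
  gen : ∀ S : Set O, IsClosed S →
    (∀ a, rep.π a ∈ S) → (∀ s x, rep.ψ s x ∈ S) →
    (∀ p q, p ∈ S → q ∈ S → p + q ∈ S) →
    (∀ p q, p ∈ S → q ∈ S → p * q ∈ S) →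
    (∀ (c : ℂ) p, p ∈ S → c • p ∈ S) →
    (∀ p, p ∈ S → star p ∈ S) → ∀ z, z ∈ S
  universal : ∀ (C : Type u) [NonUnitalCStarAlgebra C],
    ∀ r : PSRep Xs C, PSCPCov r →
      ∃! h : O →⋆ₙₐ[ℂ] C,
        (∀ a, h (rep.π a) = r.π a) ∧ ∀ s x, h (rep.ψ s x) = r.ψ s x

attribute [instance] PSCPAlg.alg

/- ##################  generating systems  ################## -/

/-- a realization of a triple tensor product `W1 ⊗ W2 ⊗ W3` carrying both
a left pairing `(W1 ⊗ W2) ⊗ W3` and a right pairing `W1 ⊗ (W2 ⊗ W3)` -/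
structure Trip (W1 W2 W3 : Corr A) (T12 : Corr A) (m12 : W1.X → W2.X → T12.X)
    (T23 : Corr A) (m23 : W2.X → W3.X → T23.X) (P : Corr A) : Type u where
  lp : T12.X → W3.X → P.X
  rp : W1.X → T23.X → P.X
  lt : IsTensor T12 W3 P lp
  rt : IsTensor W1 T23 P rp
  compat : ∀ x y z, lp (m12 x y) z = rp x (m23 y z)

/-- the hexagonal relation for a triple of flip isomorphisms
`θij, θil, θjl`, stated relative to arbitrary realizations of the six
triple tensor products. -/
def HexProp (Yi Yj Yl : Corr A)
    (Tij Tji Til Tli Tjl Tlj : Corr A)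
    (mij : Yi.X → Yj.X → Tij.X) (mji : Yj.X → Yi.X → Tji.X)
    (mil : Yi.X → Yl.X → Til.X) (mli : Yl.X → Yi.X → Tli.X)
    (mjl : Yj.X → Yl.X → Tjl.X) (mlj : Yl.X → Yj.X → Tlj.X)
    (θij : Tij.X → Tji.X) (θil : Til.X → Tli.X) (θjl : Tjl.X → Tlj.X) : Prop :=
  ∀ (P1 P2 P3 P4 P5 P6 : Corr A)
    (R1 : Trip Yi Yj Yl Tij mij Tjl mjl P1)
    (R2 : Trip Yj Yi Yl Tji mji Til mil P2)
    (R3 : Trip Yj Yl Yi Tjl mjl Tli mli P3)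
    (R4 : Trip Yl Yj Yi Tlj mlj Tji mji P4)
    (R5 : Trip Yi Yl Yj Til mil Tlj mlj P5)
    (R6 : Trip Yl Yi Yj Tli mli Tij mij P6)
    (F1 : P1.X → P2.X) (F2 : P2.X → P3.X) (F3 : P3.X → P4.X)
    (F4 : P1.X → P5.X) (F5 : P5.X → P6.X) (F6 : P6.X → P4.X),
    IsCLMap F1 → IsCLMap F2 → IsCLMap F3 →
    IsCLMap F4 → IsCLMap F5 → IsCLMap F6 →
    (∀ u z, F1 (R1.lp u z) = R2.lp (θij u) z) →
    (∀ y v, F2 (R2.rp y v) = R3.rp y (θil v)) →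
    (∀ u z, F3 (R3.lp u z) = R4.lp (θjl u) z) →
    (∀ x v, F4 (R1.rp x v) = R5.rp x (θjl v)) →
    (∀ u z, F5 (R5.lp u z) = R6.lp (θil u) z) →
    (∀ x v, F6 (R6.rp x v) = R4.rp x (θij v)) →
    ∀ w, F3 (F2 (F1 w)) = F6 (F5 (F4 w))

/-- A generating system `(Y, θ)` of `k` correspondences over `A`:
correspondences `Y i`, chosen realizations `T i j` of the tensor products
`Y i ⊗_A Y j`, and flip isomorphisms `θ i j : Y i ⊗ Y j → Y j ⊗ Y i` with
`θ i i = id`, `θ j i = (θ i j)⁻¹`, satisfying the hexagonal relations. -/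
structure GenSys (A : Type u) [NonUnitalCStarAlgebra A] (k : ℕ) : Type (u + 1) where
  Y : Fin k → Corr A
  reg : ∀ i, (Y i).Reg
  T : Fin k → Fin k → Corr A
  tmul : ∀ i j, (Y i).X → (Y j).X → (T i j).X
  isTensor : ∀ i j, IsTensor (Y i) (Y j) (T i j) (tmul i j)
  θ : ∀ i j, CorrIso (T i j) (T j i)
  θ_diag : ∀ i x y, (θ i i).toFun (tmul i i x y) = tmul i i x y
  θ_symm : ∀ i j z, (θ j i).toFun ((θ i j).toFun z) = z
  hex : ∀ i j l, HexProp (Y i) (Y j) (Y l) (T i j) (T j i) (T i l) (T l i)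
    (T j l) (T l j) (tmul i j) (tmul j i) (tmul i l) (tmul l i) (tmul j l)
    (tmul l j) ((θ i j).toFun) ((θ i l).toFun) ((θ j l).toFun)

/-- the generating system obtained by keeping only `Y 1, …, Y m` -/
def GenSys.restrict {k : ℕ} (G : GenSys A k) (m : ℕ) (h : m ≤ k) : GenSys A m where
  Y i := G.Y (Fin.castLE h i)
  reg i := G.reg _
  T i j := G.T (Fin.castLE h i) (Fin.castLE h j)
  tmul i j := G.tmul _ _
  isTensor i j := G.isTensor _ _
  θ i j := G.θ _ _
  θ_diag i := G.θ_diag _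
  θ_symm i j := G.θ_symm _ _
  hex i j l := G.hex _ _ _

/-- `X` is *the* product system (over `ℕ^k`) generated by the generating
system `G` (Fowler–Sims); witnessed by compatible isomorphisms on the
generating fibers. -/
structure Generates {k : ℕ} (G : GenSys A k) (Xs : PSys A k) : Type u where
  ι : ∀ i, CorrIso (G.Y i) (Xs.fib (egen i))
  κ : ∀ i j, CorrIso (G.T i j) (Xs.fib (egen i + egen j))
  κ_mul : ∀ i j x y,
    (κ i j).toFun (G.tmul i j x y) =
      Xs.mul (egen i) (egen j) ((ι i).toFun x) ((ι j).toFun y)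
  θ_compat : ∀ i j z,
    HEq ((κ j i).toFun ((G.θ i j).toFun z)) ((κ i j).toFun z)

/- ############  mixed tensor products `W ⊗_A O` and `W ⊗_A V`  ############ -/

/-- `Z` (a correspondence over the C*-algebra `O`), with map `m`, is a
realization of the right Hilbert `O`-module `W ⊗_A O`, where `O` is an
`A`-algebra via `πA`.  (No condition on the left action of `O` on `Z`.) -/
structure MixedMod (W : Corr A) (O : Type u) [NonUnitalCStarAlgebra O]
    (πA : A → O) (Z : Corr O) (m : W.X → O → Z.X) : Prop where
  add_left : ∀ x x' S, m (x + x') S = m x S + m x' S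
  add_right : ∀ x S S', m x (S + S') = m x S + m x S'
  smul_left : ∀ (c : ℂ) x S, m (c • x) S = c • m x S
  smul_right : ∀ (c : ℂ) x S, m x (c • S) = c • m x S
  balanced : ∀ x a S, m (W.ract x a) S = m x (πA a * S)
  ract : ∀ x S T, Z.ract (m x S) T = m x (S * T)
  inner : ∀ x S y T, Z.inner (m x S) (m y T) = star S * (πA (W.inner x y) * T)
  dense : closure (Submodule.span ℂ {z : Z.X | ∃ x S, z = m x S} : Set Z.X) = Set.univ

/-- `P`, with pairing `p`, is a realization of the balanced tensor product
`W ⊗_A V` where `W` is a correspondence over `A` and `V` a correspondence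
over the `A`-algebra `O` (via `πA`); the left `A`-action is `πA`-compatible. -/
structure MixedPair (W : Corr A) {O : Type u} [NonUnitalCStarAlgebra O]
    (πA : A → O) (V P : Corr O) (p : W.X → V.X → P.X) : Prop where
  add_left : ∀ x x' v, p (x + x') v = p x v + p x' v
  add_right : ∀ x v v', p x (v + v') = p x v + p x v'
  smul_left : ∀ (c : ℂ) x v, p (c • x) v = c • p x v
  smul_right : ∀ (c : ℂ) x v, p x (c • v) = c • p x v
  balanced : ∀ x a v, p (W.ract x a) v = p x (V.lactL (πA a) v)
  inner : ∀ x v x' v',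
    P.inner (p x v) (p x' v') = V.inner v (V.lactL (πA (W.inner x x')) v')
  ract : ∀ x v S, P.ract (p x v) S = p x (V.ract v S)
  lact_pi : ∀ a x v, P.lactL (πA a) (p x v) = p (W.lactL a x) v
  dense : closure (Submodule.span ℂ {z : P.X | ∃ x v, z = p x v} : Set P.X) = Set.univ

/- ############  the correspondence `ℰYᵢ = Yᵢ ⊗_A 𝒪(Y₁)`  ############ -/

/-- `Z = Yi ⊗_A 𝒪(Y1)` with the left `𝒪(Y1)`-action determined by the flip
`θ : Y1 ⊗ Yi → Yi ⊗ Y1` (`T` and `T'` are realizations of these tensor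
products):  `π(a)` acts by `φ(a) ⊗ 1`, and `t(x)·(y ⊗ S) = (1 ⊗ V)(θ ⊗ 1)
(x ⊗ y ⊗ S)`. -/
structure ECorrData (Y1 Yi : Corr A)
    (T : Corr A) (mT : Y1.X → Yi.X → T.X)
    (T' : Corr A) (mT' : Yi.X → Y1.X → T'.X)
    (θ : T.X → T'.X)
    (C : CPAlg Y1) (Z : Corr C.O) (m : Yi.X → C.O → Z.X) : Prop where
  mod : MixedMod Yi C.O C.π Z m
  lact_pi : ∀ a y S, Z.lactL (C.π a) (m y S) = m (Yi.lactL a y) S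
  lact_t : ∃ μ : T'.X → C.O → Z.X,
    (∀ S, IsCLMap fun u => μ u S) ∧
    (∀ y u S, μ (mT' y u) S = m y (C.t u * S)) ∧
    ∀ x y S, Z.lactL (C.t x) (m y S) = μ (θ (mT x y)) S

/-- `Z = Yi ⊗_A 𝒪(Y p)` for a generating system `G`, with left action
determined by `θ p i` -/
def ECorr {k : ℕ} (G : GenSys A k) (p i : Fin k) (C : CPAlg (G.Y p))
    (Z : Corr C.O) (m : (G.Y i).X → C.O → Z.X) : Prop :=
  ECorrData (G.Y p) (G.Y i) (G.T p i) (G.tmul p i) (G.T i p) (G.tmul i p)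
    ((G.θ p i).toFun) C Z m

/-- `Z = Y j ⊗_A 𝒪(Y 1 ∗ ⋯ ∗ Y m)` with the left action of the
Cuntz–Pimsner algebra of the product system determined on the generators
`σ i = ψ_{e i}` via the flips `θ i j` and the absorption maps. -/
structure EPCorr {k : ℕ} (G : GenSys A k) {m : ℕ} (hm : m ≤ k)
    (Xs : PSys A m) (gen : Generates (G.restrict m hm) Xs) (C : PSCPAlg Xs)
    (j : Fin k) (Z : Corr C.O) (mm : (G.Y j).X → C.O → Z.X) : Prop where
  mod : MixedMod (G.Y j) C.O C.rep.π Z mm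
  lact_pi : ∀ a y S, Z.lactL (C.rep.π a) (mm y S) = mm ((G.Y j).lactL a y) S
  lact_t : ∀ i : Fin m,
    ∃ μ : (G.T j (Fin.castLE hm i)).X → C.O → Z.X,
      (∀ S, IsCLMap fun u => μ u S) ∧
      (∀ y u S, μ (G.tmul j (Fin.castLE hm i) y u) S =
        mm y (C.rep.ψ (egen i) ((gen.ι i).toFun u) * S)) ∧
      ∀ x y S, Z.lactL (C.rep.ψ (egen i) ((gen.ι i).toFun x)) (mm y S) =
        μ ((G.θ (Fin.castLE hm i) j).toFun (G.tmul (Fin.castLE hm i) j x y)) S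

/- ############  the isomorphism `ℛθ = ν⁻¹ (θ ⊗ 1) ν`  ############ -/

/-- Witness data expressing that `R : Zi ⊗_O Zj → Zj ⊗_O Zi` is the map
`ℛθ_{ij} = ν_{ji}⁻¹ (θ_{ij} ⊗ 1_O) ν_{ij}` of the paper, where
`Zi = Yi ⊗_A O`, `O = 𝒪(Y1)`, and `ν_{ij} : (Yi ⊗ O) ⊗_O (Yj ⊗ O) ≅
Yi ⊗ Yj ⊗ O` is the canonical absorption isomorphism. -/
structure RTheta (O : Type u) [NonUnitalCStarAlgebra O] (πA : A → O)
    (Yi Yj : Corr A) (Tij Tji : Corr A)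
    (mij : Yi.X → Yj.X → Tij.X) (mji : Yj.X → Yi.X → Tji.X)
    (θij : Tij.X → Tji.X)
    (Zi Zj : Corr O) (mmi : Yi.X → O → Zi.X) (mmj : Yj.X → O → Zj.X)
    (TZ TZr : Corr O) (mZ : Zi.X → Zj.X → TZ.X) (mZr : Zj.X → Zi.X → TZr.X)
    (R : TZ.X → TZr.X) : Type (u + 1) where
  Pl : Corr O
  Pr : Corr O
  pij : Yi.X → Zj.X → Pl.X
  pji : Yj.X → Zi.X → Pr.X
  hp : MixedPair Yi πA Zj Pl pij
  hpr : MixedPair Yj πA Zi Pr pji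
  q : Tij.X → O → Pl.X
  qr : Tji.X → O → Pr.X
  hq : MixedMod Tij O πA Pl q
  hqr : MixedMod Tji O πA Pr qr
  q_compat : ∀ x y S, q (mij x y) S = pij x (mmj y S)
  q_compatr : ∀ y x S, qr (mji y x) S = pji y (mmi x S)
  ν : TZ.X → Pl.X
  νr : TZr.X → Pr.X
  hν : IsCLMap ν ∧ Function.Bijective ν ∧
    ∀ x S ζ, ν (mZ (mmi x S) ζ) = pij x (Zj.lactL S ζ)
  hνr : IsCLMap νr ∧ Function.Bijective νr ∧
    ∀ y S ζ, νr (mZr (mmj y S) ζ) = pji y (Zi.lactL S ζ)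
  Θ : Pl.X → Pr.X
  hΘ : IsCLMap Θ ∧ ∀ u S, Θ (q u S) = qr (θij u) S
  hR : ∀ z, νr (R z) = Θ (ν z)

/-! ### Closed spans -/

/-- The closed linear span of a set. -/
def clspan {E : Type*} [NormedAddCommGroup E] [NormedSpace ℂ E] (s : Set E) : Submodule ℂ E :=
  (Submodule.span ℂ s).topologicalClosure

section ClosedSpan

variable {E F : Type*} [NormedAddCommGroup E] [NormedSpace ℂ E]
  [NormedAddCommGroup F] [NormedSpace ℂ F]

theorem isClosed_clspan (s : Set E) : IsClosed (clspan s : Set E) :=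
  Submodule.isClosed_topologicalClosure _

theorem subset_clspan (s : Set E) : s ⊆ clspan s :=
  Submodule.subset_span.trans (Submodule.le_topologicalClosure _)

theorem clspan_le {s : Set E} {K : Submodule ℂ E} (hK : IsClosed (K : Set E)) (h : s ⊆ K) :
    clspan s ≤ K :=
  Submodule.topologicalClosure_minimal _ (Submodule.span_le.2 h) hK

theorem map_mem_of_mem_clspan (f : E →L[ℂ] F) {s : Set E} {K : Submodule ℂ F}
    (hK : IsClosed (K : Set F)) (h : ∀ x ∈ s, f x ∈ K) {x : E} (hx : x ∈ clspan s) : f x ∈ K :=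
  clspan_le (K := K.comap (f : E →ₗ[ℂ] F)) (hK.preimage f.continuous) h hx

theorem clspan_eq_top {s : Set E}
    (h : closure (Submodule.span ℂ s : Set E) = Set.univ) : clspan s = ⊤ :=
  SetLike.coe_injective (by simpa [clspan] using h)

theorem eqOn_clspan {f g : E →L[ℂ] F} {s : Set E} (h : ∀ x ∈ s, f x = g x) {x : E}
    (hx : x ∈ clspan s) : f x = g x := by
  have := map_mem_of_mem_clspan (f - g) (K := ⊥) isClosed_singleton
    (fun x hx => by simp [h x hx]) hx
  simpa [sub_eq_zero] using this

theorem eq_of_dense_span {f g : E →L[ℂ] F} {s : Set E}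
    (hs : closure (Submodule.span ℂ s : Set E) = Set.univ) (h : ∀ x ∈ s, f x = g x) (x : E) :
    f x = g x :=
  eqOn_clspan h (by rw [clspan_eq_top hs]; trivial)

theorem mem_of_dense_span (f : E →L[ℂ] F) {s : Set E} {K : Submodule ℂ F}
    (hs : closure (Submodule.span ℂ s : Set E) = Set.univ)
    (hK : IsClosed (K : Set F)) (h : ∀ x ∈ s, f x ∈ K) (x : E) : f x ∈ K :=
  map_mem_of_mem_clspan f hK h (by rw [clspan_eq_top hs]; trivial)

/-- The domain of a closed linear relation with a norm bound is closed. -/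
theorem isClosed_domain_of_bound [CompleteSpace E] [CompleteSpace F] (S : Submodule ℂ (E × F))
    (hS : IsClosed (S : Set (E × F))) (C : ℝ) (hC : ∀ p ∈ S, ‖p.2‖ ≤ C * ‖p.1‖) :
    IsClosed (S.map (LinearMap.fst ℂ E F) : Set E) := by
  have hcs : CompleteSpace S := hS.completeSpace_coe
  let f : S →L[ℂ] E := (ContinuousLinearMap.fst ℂ E F).comp S.subtypeL
  have hf : AntilipschitzWith (max 1 C).toNNReal f := by
    refine f.antilipschitz_of_bound fun p => ?_
    rw [Real.coe_toNNReal _ (by positivity)]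
    have h1 := hC p.1 p.2
    have h2 : ‖(p : E × F)‖ ≤ max 1 C * ‖(p : E × F).1‖ := by
      rw [Prod.norm_def]
      refine max_le ?_ (h1.trans ?_)
      · exact le_mul_of_one_le_left (norm_nonneg _) (le_max_left _ _)
      · exact mul_le_mul_of_nonneg_right (le_max_right _ _) (norm_nonneg _)
    exact h2
  have := hf.isClosed_range f.uniformContinuous
  convert this using 1
  ext x
  simp [f]

/-- A bounded linear relation with dense domain extends to a bounded operator. -/
theorem exists_clm_of_relation [CompleteSpace E] [CompleteSpace F] {I : Type*} (f : I → E)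
    (g : I → F) (hf : closure (Submodule.span ℂ (Set.range f) : Set E) = Set.univ) (C : ℝ)
    (hC : ∀ p ∈ Submodule.span ℂ (Set.range fun i => (f i, g i)), ‖p.2‖ ≤ C * ‖p.1‖) :
    ∃ T : E →L[ℂ] F, ∀ i, T (f i) = g i := by
  set S := clspan (Set.range fun i => (f i, g i)) with hSdef
  have hS : IsClosed (S : Set (E × F)) := isClosed_clspan _
  have hb : ∀ p ∈ S, ‖p.2‖ ≤ C * ‖p.1‖ := by
    intro p hp
    have hcl : IsClosed {p : E × F | ‖p.2‖ ≤ C * ‖p.1‖} :=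
      isClosed_le (by fun_prop) (by fun_prop)
    exact closure_minimal hC hcl hp
  have hdom := isClosed_domain_of_bound S hS C hb
  have hex : ∀ x, ∃ y, (x, y) ∈ S := by
    intro x
    have := mem_of_dense_span (ContinuousLinearMap.id ℂ E) hf hdom (by
      rintro _ ⟨i, rfl⟩
      exact ⟨(f i, g i), subset_clspan _ ⟨i, rfl⟩, rfl⟩) x
    obtain ⟨⟨a, b⟩, hab, rfl⟩ := this
    exact ⟨b, hab⟩
  have huniq : ∀ x y y', (x, y) ∈ S → (x, y') ∈ S → y = y' := by
    intro x y y' h h'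
    have := hb _ (S.sub_mem h h')
    simpa [sub_eq_zero] using this
  choose T hT using hex
  let L : E →ₗ[ℂ] F :=
    { toFun := T
      map_add' := fun x y => huniq _ _ _ (hT _) (S.add_mem (hT x) (hT y))
      map_smul' := fun c x => huniq _ _ _ (hT _) (S.smul_mem c (hT x)) }
  exact ⟨L.mkContinuous C fun x => hb _ (hT x),
    fun i => huniq _ _ _ (hT _) (subset_clspan _ ⟨i, rfl⟩)⟩

end ClosedSpan

/-- The continuous linear map underlying an `IsCLMap`. -/
def IsCLMap.toCLM {E F : Type u} [NormedAddCommGroup E] [NormedSpace ℂ E]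
    [NormedAddCommGroup F] [NormedSpace ℂ F] {f : E → F} (hf : IsCLMap f) : E →L[ℂ] F where
  toFun := f
  map_add' := hf.map_add
  map_smul' := hf.map_smul
  cont := hf.cont

/-! ### Algebra-valued inner products -/

/-- A sesquilinear algebra-valued form inducing the norm (no positivity is required). -/
structure IsIp {E : Type*} (R : Type*) [NormedAddCommGroup E] [NormedSpace ℂ E]
    [NonUnitalCStarAlgebra R] (ip : E → E → R) : Prop where
  add_right : ∀ x y z, ip x (y + z) = ip x y + ip x z
  smul_right : ∀ (c : ℂ) x y, ip x (c • y) = c • ip x y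
  star_eq : ∀ x y, star (ip x y) = ip y x
  norm_eq : ∀ x, ‖x‖ ^ 2 = ‖ip x x‖

theorem Corr.isIp {R : Type u} [NonUnitalCStarAlgebra R] (W : Corr R) : IsIp R W.inner :=
  ⟨W.inner_add_right, W.inner_smul_right, W.inner_star, W.norm_eq⟩

theorem isIp_mul (R : Type*) [NonUnitalCStarAlgebra R] :
    IsIp R (fun x y : R => star x * y) where
  add_right x y z := mul_add _ _ _
  smul_right c x y := mul_smul_comm _ _ _
  star_eq x y := by simp
  norm_eq x := by rw [CStarRing.norm_star_mul_self, sq]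

namespace IsIp

variable {E R : Type*} [NormedAddCommGroup E] [NormedSpace ℂ E] [NonUnitalCStarAlgebra R]
  {ip : E → E → R}

theorem add_left (h : IsIp R ip) (x y z : E) : ip (x + y) z = ip x z + ip y z := by
  rw [← h.star_eq, h.add_right, star_add, h.star_eq, h.star_eq]

theorem smul_left (h : IsIp R ip) (c : ℂ) (x y : E) : ip (c • x) y = star c • ip x y := by
  rw [← h.star_eq, h.smul_right, star_smul, h.star_eq]

theorem polarization (h : IsIp R ip) (x y : E) : (4 : ℂ) • ip x y =
    ip (x + y) (x + y) - ip (x + (-1 : ℂ) • y) (x + (-1 : ℂ) • y)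
      - Complex.I • ip (x + Complex.I • y) (x + Complex.I • y)
      + Complex.I • ip (x + (-Complex.I) • y) (x + (-Complex.I) • y) := by
  simp only [h.add_left, h.add_right, h.smul_left, h.smul_right, smul_add, smul_smul]
  simp only [star_neg, star_one, Complex.star_def, Complex.conj_I]
  match_scalars <;> ring_nf <;> simp
  norm_num

theorem norm_le_add_sq (h : IsIp R ip) (x y : E) : ‖ip x y‖ ≤ (‖x‖ + ‖y‖) ^ 2 := by
  have key : ∀ c : ℂ, ‖c‖ = 1 → ‖ip (x + c • y) (x + c • y)‖ ≤ (‖x‖ + ‖y‖) ^ 2 := by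
    intro c hc
    rw [← h.norm_eq]
    have := norm_add_le x (c • y)
    rw [norm_smul, hc, one_mul] at this
    gcongr
  have h1 := key 1 (by simp)
  have h2 := key (-1) (by simp)
  have h3 := key Complex.I (by simp)
  have h4 := key (-Complex.I) (by simp)
  rw [one_smul] at h1
  have h5 : ‖(4 : ℂ) • ip x y‖ = 4 * ‖ip x y‖ := by rw [norm_smul]; norm_num
  rw [h.polarization] at h5
  have h6 := norm_add_le (ip (x + y) (x + y) - ip (x + (-1 : ℂ) • y) (x + (-1 : ℂ) • y)
      - Complex.I • ip (x + Complex.I • y) (x + Complex.I • y))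
      (Complex.I • ip (x + (-Complex.I) • y) (x + (-Complex.I) • y))
  have h7 := norm_sub_le (ip (x + y) (x + y) - ip (x + (-1 : ℂ) • y) (x + (-1 : ℂ) • y))
      (Complex.I • ip (x + Complex.I • y) (x + Complex.I • y))
  have h8 := norm_sub_le (ip (x + y) (x + y)) (ip (x + (-1 : ℂ) • y) (x + (-1 : ℂ) • y))
  rw [norm_smul, Complex.norm_I, one_mul] at h6 h7
  linarith

theorem zero_right (h : IsIp R ip) (x : E) : ip x 0 = 0 := by
  simpa using h.smul_right 0 x 0

theorem zero_left (h : IsIp R ip) (x : E) : ip 0 x = 0 := by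
  simpa using h.smul_left 0 0 x

/-- A Cauchy–Schwarz type bound, obtained from polarization alone. -/
theorem norm_le (h : IsIp R ip) (x y : E) : ‖ip x y‖ ≤ 4 * ‖x‖ * ‖y‖ := by
  rcases eq_or_ne x 0 with rfl | hx
  · simp [h.zero_left]
  rcases eq_or_ne y 0 with rfl | hy
  · simp [h.zero_right]
  have hx' : 0 < ‖x‖ := norm_pos_iff.2 hx
  have hy' : 0 < ‖y‖ := norm_pos_iff.2 hy
  have := h.norm_le_add_sq (((‖x‖⁻¹ : ℝ) : ℂ) • x) (((‖y‖⁻¹ : ℝ) : ℂ) • y)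
  rw [h.smul_left, h.smul_right, norm_smul, norm_smul, norm_smul, norm_smul, norm_star,
    Complex.norm_real, Complex.norm_real, norm_inv, norm_inv, norm_norm, norm_norm,
    inv_mul_cancel₀ hx'.ne', inv_mul_cancel₀ hy'.ne'] at this
  have h2 : ‖ip x y‖ = ‖x‖ * ‖y‖ * (‖x‖⁻¹ * (‖y‖⁻¹ * ‖ip x y‖)) := by
    field_simp
  rw [h2]
  calc ‖x‖ * ‖y‖ * (‖x‖⁻¹ * (‖y‖⁻¹ * ‖ip x y‖)) ≤ ‖x‖ * ‖y‖ * (1 + 1) ^ 2 := by gcongr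
    _ = 4 * ‖x‖ * ‖y‖ := by ring

theorem eq_zero_of_self (h : IsIp R ip) {x : E} (hx : ip x x = 0) : x = 0 := by
  have := h.norm_eq x
  rw [hx, norm_zero] at this
  exact norm_eq_zero.1 (pow_eq_zero_iff two_ne_zero |>.1 this)

theorem ext_left (h : IsIp R ip) {x y : E} (hxy : ∀ z, ip z x = ip z y) : x = y := by
  refine sub_eq_zero.1 (h.eq_zero_of_self ?_)
  rw [sub_eq_add_neg, ← neg_one_smul ℂ y, h.add_right, h.smul_right, hxy]
  simp

/-- The form as a continuous linear map in its second argument. -/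
def rightCLM (h : IsIp R ip) (x : E) : E →L[ℂ] R :=
  LinearMap.mkContinuous
    { toFun := ip x, map_add' := h.add_right x, map_smul' := fun c y => h.smul_right c x y }
    (4 * ‖x‖) (h.norm_le x)

theorem rightCLM_apply (h : IsIp R ip) (x y : E) : h.rightCLM x y = ip x y := rfl

theorem continuous_left (h : IsIp R ip) (y : E) : Continuous fun x => ip x y := by
  have : (fun x => ip x y) = fun x => star (h.rightCLM y x) :=
    funext fun x => (h.star_eq y x).symm
  rw [this]
  exact continuous_star.comp (h.rightCLM y).continuous

theorem sq_norm_iterate_le (h : IsIp R ip) (T : E → E)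
    (hT : ∀ x y, ip (T x) y = ip x (T y)) (x : E) (m : ℕ) :
    ‖T^[m] x‖ ^ 2 ≤ 4 * ‖x‖ * ‖T^[2 * m] x‖ := by
  have key : ∀ m x y, ip (T^[m] x) y = ip x (T^[m] y) := by
    intro m
    induction m with
    | zero => intros; rfl
    | succ m ih =>
      intro x y
      rw [Function.iterate_succ_apply, ih, hT, ← Function.iterate_succ_apply' T]
  rw [h.norm_eq, key, ← Function.iterate_add_apply, two_mul]
  exact h.norm_le _ _

/-- A symmetric operator whose orbit of `x` grows at most like `M ^ m` satisfies
`‖T x‖ ≤ 4 M ‖x‖`. -/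
theorem norm_apply_le_of_growth (h : IsIp R ip) (T : E → E)
    (hT : ∀ x y, ip (T x) y = ip x (T y)) (x : E) {C M : ℝ} (hM : 0 < M)
    (hC : ∀ m, ‖T^[m] x‖ ≤ C * M ^ m) : ‖T x‖ ≤ 4 * ‖x‖ * M := by
  rcases eq_or_ne x 0 with rfl | hx
  · have h0 := h.sq_norm_iterate_le T hT 0 1
    simp only [norm_zero, mul_zero, zero_mul] at h0
    have : ‖T 0‖ = 0 := by
      have h1 : ‖T^[1] (0 : E)‖ ^ 2 = 0 := le_antisymm h0 (sq_nonneg _)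
      simpa using h1
    simp [this]
  have hx' : 0 < 4 * ‖x‖ := by positivity
  by_contra! hlt
  set q := ‖T x‖ / (4 * ‖x‖ * M) with hq
  have hq1 : 1 < q := by rw [hq, one_lt_div (by positivity)]; exact hlt
  have key : ∀ m : ℕ, 4 * ‖x‖ * (q * M) ^ (2 ^ m) ≤ ‖T^[2 ^ m] x‖ := by
    intro m
    induction m with
    | zero =>
      have : 4 * ‖x‖ * (q * M) = ‖T x‖ := by rw [hq]; field_simp
      simp [this]
    | succ m ih =>
      have h1 := h.sq_norm_iterate_le T hT x (2 ^ m)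
      have h2 : (4 * ‖x‖ * (q * M) ^ (2 ^ m)) ^ 2 ≤ ‖T^[2 ^ m] x‖ ^ 2 := by
        gcongr
      rw [pow_succ' 2 m]
      have h3 := h2.trans h1
      have h4 : (4 * ‖x‖ * (q * M) ^ (2 ^ m)) ^ 2 =
          4 * ‖x‖ * (4 * ‖x‖ * (q * M) ^ (2 * 2 ^ m)) := by ring
      rw [h4] at h3
      exact le_of_mul_le_mul_left h3 hx'
  have hbd : ∀ m : ℕ, q ^ (2 ^ m) ≤ C / (4 * ‖x‖) := by
    intro m
    rw [le_div_iff₀ hx']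
    have := (key m).trans (hC _)
    rw [mul_pow, ← mul_assoc] at this
    have := le_of_mul_le_mul_right this (by positivity)
    linarith
  have ht : Tendsto (fun m : ℕ => q ^ (2 ^ m)) atTop atTop :=
    (tendsto_pow_atTop_atTop_of_one_lt hq1).comp (tendsto_pow_atTop_atTop_of_one_lt one_lt_two)
  obtain ⟨m, hm⟩ := (ht.eventually_gt_atTop (C / (4 * ‖x‖))).exists
  exact absurd (hbd m) (not_le.2 hm)

/-- A map between generators of modules with inner products which intertwines the Gram matrices
extends to a bounded operator. -/
theorem exists_clm {F R' : Type*} [NormedAddCommGroup F] [NormedSpace ℂ F]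
    [NonUnitalCStarAlgebra R'] {ip' : F → F → R'} [CompleteSpace E] [CompleteSpace F]
    (h : IsIp R ip) (h' : IsIp R' ip') (Φ : R →L[ℂ] R') {I : Type*} (f : I → E) (g : I → F)
    (hf : closure (Submodule.span ℂ (Set.range f) : Set E) = Set.univ)
    (hfg : ∀ i j, ip' (g i) (g j) = Φ (ip (f i) (f j))) :
    ∃ T : E →L[ℂ] F, (∀ i, T (f i) = g i) ∧ ∀ x y, ip' (T x) (T y) = Φ (ip x y) := by
  have gram : ∀ p ∈ Submodule.span ℂ (Set.range fun i => (f i, g i)),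
      ∀ q ∈ Submodule.span ℂ (Set.range fun i => (f i, g i)),
        ip' p.2 q.2 = Φ (ip p.1 q.1) := by
    intro p hp q hq
    induction hp using Submodule.span_induction with
    | mem p hp =>
      obtain ⟨i, rfl⟩ := hp
      induction hq using Submodule.span_induction with
      | mem q hq => obtain ⟨j, rfl⟩ := hq; exact hfg i j
      | zero => simp [h.zero_right, h'.zero_right]
      | add q q' _ _ hq hq' =>
        simp only [Prod.snd_add, Prod.fst_add, h.add_right, h'.add_right, map_add] at *
        rw [hq, hq']
      | smul c q _ hq =>
        simp only [Prod.smul_snd, Prod.smul_fst, h.smul_right, h'.smul_right, map_smul] at *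
        rw [hq]
    | zero => simp [h.zero_left, h'.zero_left]
    | add p p' _ _ hp hp' =>
      simp only [Prod.snd_add, Prod.fst_add, h.add_left, h'.add_left, map_add] at *
      rw [hp, hp']
    | smul c p _ hp =>
      simp only [Prod.smul_snd, Prod.smul_fst, h.smul_left, h'.smul_left, map_smul] at *
      rw [hp]
  obtain ⟨T, hT⟩ := exists_clm_of_relation f g hf (Real.sqrt ‖Φ‖) (by
    intro p hp
    have h1 := gram p hp p hp
    have h2 : ‖p.2‖ ^ 2 ≤ ‖Φ‖ * ‖p.1‖ ^ 2 := by
      rw [h.norm_eq, h'.norm_eq, h1]; exact Φ.le_opNorm _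
    refine le_of_sq_le_sq ?_ (by positivity)
    rwa [mul_pow, Real.sq_sqrt (norm_nonneg _)])
  refine ⟨T, hT, fun x y => ?_⟩
  have step : ∀ i y, ip' (T (f i)) (T y) = Φ (ip (f i) y) := fun i y =>
    eq_of_dense_span (f := (h'.rightCLM (T (f i))).comp T) (g := Φ.comp (h.rightCLM (f i))) hf
      (by rintro _ ⟨j, rfl⟩; simp [rightCLM_apply, hT, hfg]) y
  let K : Submodule ℂ E :=
    { carrier := {x | ∀ y, ip' (T x) (T y) = Φ (ip x y)}
      add_mem' := fun ha hb y => by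
        simp only [h.add_left, h'.add_left, map_add, ha y, hb y]
      zero_mem' := fun y => by simp [h.zero_left, h'.zero_left]
      smul_mem' := fun c x hx y => by
        simp only [h.smul_left, h'.smul_left, map_smul, hx y] }
  have hK : IsClosed (K : Set E) := by
    have : (K : Set E) = ⋂ y, {x | ip' (T x) (T y) = Φ (ip x y)} := by
      ext x; simp [K]
    rw [this]
    exact isClosed_iInter fun y => isClosed_eq ((h'.continuous_left _).comp T.continuous)
      (Φ.continuous.comp (h.continuous_left _))
  exact mem_of_dense_span (ContinuousLinearMap.id ℂ E) hf hK
    (by rintro _ ⟨i, rfl⟩; exact step i) x y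

end IsIp

/-! ### Elementary facts about C*-algebras and *-homomorphisms -/

section StarHom

variable {R S : Type u} [NonUnitalCStarAlgebra R] [NonUnitalCStarAlgebra S]

/-- Bundle a *-homomorphism. -/
def IsStarHom.toHom {π : R → S} (h : IsStarHom π) : R →⋆ₙₐ[ℂ] S where
  toFun := π
  map_smul' := h.map_smul
  map_zero' := by simpa using h.map_smul 0 0
  map_add' := h.map_add
  map_mul' := h.map_mul
  map_star' := h.map_star

/-- A *-homomorphism as a continuous linear map. -/
def homCLM (f : R →⋆ₙₐ[ℂ] S) : R →L[ℂ] S :=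
  LinearMap.mkContinuous
    { toFun := f, map_add' := map_add f, map_smul' := map_smul f } 1
    (fun x => by simpa using NonUnitalStarAlgHom.norm_apply_le f x)

@[simp] theorem homCLM_apply (f : R →⋆ₙₐ[ℂ] S) (x : R) : homCLM f x = f x := rfl

/-- A *-homomorphism as a continuous linear map. -/
def IsStarHom.toCLM {π : R → S} (h : IsStarHom π) : R →L[ℂ] S := homCLM h.toHom

@[simp] theorem IsStarHom.toCLM_apply {π : R → S} (h : IsStarHom π) (x : R) :
    h.toCLM x = π x := rfl

theorem IsStarHom.norm_le {π : R → S} (h : IsStarHom π) (x : R) : ‖π x‖ ≤ ‖x‖ :=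
  NonUnitalStarAlgHom.norm_apply_le h.toHom x

theorem IsStarHom.norm_eq {π : R → S} (h : IsStarHom π) (hi : Function.Injective π) (x : R) :
    ‖π x‖ = ‖x‖ :=
  NonUnitalStarAlgHom.norm_map h.toHom hi x

theorem isStarHom_comp {T : Type u} [NonUnitalCStarAlgebra T] (f : S →⋆ₙₐ[ℂ] T) {π : R → S}
    (h : IsStarHom π) : IsStarHom fun a => f (π a) where
  map_add a b := by rw [h.map_add, map_add]
  map_mul a b := by rw [h.map_mul, map_mul]
  map_star a := by rw [h.map_star, map_star]
  map_smul c a := by rw [h.map_smul, map_smul]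

theorem exists_approx_unit (a : R) {ε : ℝ} (hε : 0 < ε) :
    ∃ e : R, ‖e‖ ≤ 1 ∧ ‖a - a * e‖ < ε := by
  let _ := CStarAlgebra.spectralOrder R
  let _ := CStarAlgebra.spectralOrderedRing R
  have hu := CStarAlgebra.increasingApproximateUnit R
  have := hu.neBot
  have h1 := hu.tendsto_mul_left a
  rw [Metric.tendsto_nhds] at h1
  obtain ⟨e, he, he'⟩ := ((h1 ε hε).and hu.eventually_norm).exists
  exact ⟨e, he', by rwa [dist_comm, dist_eq_norm] at he⟩

/-- Left multiplication as a continuous linear map. -/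
def mulL (a : R) : R →L[ℂ] R := ContinuousLinearMap.mul ℂ R a

/-- Right multiplication as a continuous linear map. -/
def mulR (a : R) : R →L[ℂ] R := (ContinuousLinearMap.mul ℂ R).flip a

@[simp] theorem mulL_apply (a b : R) : mulL a b = a * b := rfl

@[simp] theorem mulR_apply (a b : R) : mulR a b = b * a := rfl

theorem eq_zero_of_forall_mul {d : R} (h : ∀ b, d * b = 0) : d = 0 := by
  have h1 : ‖d * star d‖ = ‖d‖ * ‖d‖ := CStarRing.norm_self_mul_star
  rw [h, norm_zero] at h1
  exact norm_eq_zero.1 (mul_self_eq_zero.1 h1.symm)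

theorem eq_of_forall_mul {x y : R} (h : ∀ b, x * b = y * b) : x = y :=
  sub_eq_zero.1 (eq_zero_of_forall_mul fun b => by rw [sub_mul, h, sub_self])

end StarHom

/-! ### Elementary facts about correspondences -/

namespace Corr

variable {R : Type u} [NonUnitalCStarAlgebra R] (W : Corr R)

theorem inner_ract_left (x y : W.X) (a : R) :
    W.inner (W.ract x a) y = star a * W.inner x y := by
  rw [← W.inner_star, W.inner_ract_right, star_mul, W.inner_star]

theorem norm_ract_le (x : W.X) (a : R) : ‖W.ract x a‖ ≤ ‖x‖ * ‖a‖ := by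
  refine le_of_sq_le_sq ?_ (by positivity)
  rw [W.norm_eq, inner_ract_left, W.inner_ract_right, mul_pow, W.norm_eq]
  calc ‖star a * (W.inner x x * a)‖ ≤ ‖star a‖ * (‖W.inner x x‖ * ‖a‖) :=
        (norm_mul_le _ _).trans (by gcongr; exact norm_mul_le _ _)
    _ = ‖W.inner x x‖ * ‖a‖ ^ 2 := by rw [norm_star]; ring

/-- Right multiplication by an algebra element. -/
def ractCLM (a : R) : W.X →L[ℂ] W.X :=
  LinearMap.mkContinuous
    { toFun := fun x => W.ract x a
      map_add' := fun x y => W.ract_add_left x y a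
      map_smul' := fun c x => W.ract_smul c x a } ‖a‖
    (fun x => (W.norm_ract_le x a).trans_eq (mul_comm _ _))

@[simp] theorem ractCLM_apply (a : R) (x : W.X) : W.ractCLM a x = W.ract x a := rfl

/-- The right orbit map of a vector. -/
def ractCLM' (x : W.X) : R →L[ℂ] W.X :=
  LinearMap.mkContinuous
    { toFun := fun a => W.ract x a
      map_add' := fun a b => W.ract_add_right x a b
      map_smul' := fun c a => W.ract_smul' c x a } ‖x‖ (W.norm_ract_le x)

@[simp] theorem ractCLM'_apply (a : R) (x : W.X) : W.ractCLM' x a = W.ract x a := rfl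

theorem mem_clspan_ract (x : W.X) : x ∈ clspan {y | ∃ a, y = W.ract x a} := by
  refine closure_mono Submodule.subset_span (Metric.mem_closure_iff.2 fun ε hε => ?_)
  obtain ⟨e, he, hxe⟩ := exists_approx_unit (W.inner x x) (ε := ε ^ 2 / 2) (by positivity)
  refine ⟨W.ract x e, ⟨e, rfl⟩, ?_⟩
  rw [dist_eq_norm]
  refine lt_of_pow_lt_pow_left₀ 2 hε.le ?_
  have h1 : W.inner (x - W.ract x e) (x - W.ract x e) =
      (W.inner x x - W.inner x x * e) - star e * (W.inner x x - W.inner x x * e) := by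
    have h := W.isIp
    rw [sub_eq_add_neg, ← neg_one_smul ℂ (W.ract x e), h.add_left, h.add_right, h.add_right,
      h.smul_left, h.smul_right, h.smul_left, h.smul_right, inner_ract_left,
      W.inner_ract_right, inner_ract_left, W.inner_ract_right, mul_sub]
    simp only [star_neg, star_one, neg_smul, one_smul, smul_neg]
    abel
  rw [W.norm_eq, h1]
  calc _ ≤ ‖W.inner x x - W.inner x x * e‖ + ‖star e‖ * ‖W.inner x x - W.inner x x * e‖ :=
        (norm_sub_le _ _).trans (by gcongr; exact norm_mul_le _ _)
    _ ≤ ‖W.inner x x - W.inner x x * e‖ + 1 * ‖W.inner x x - W.inner x x * e‖ := by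
        gcongr; rwa [norm_star]
    _ < ε ^ 2 := by linarith

/-- The left action as an algebra homomorphism. -/
def lactHom : R →ₙₐ[ℂ] (W.X →L[ℂ] W.X) where
  toFun := W.lactL
  map_smul' := W.lact_smul
  map_zero' := by simpa using W.lact_smul 0 0
  map_add' := W.lact_add
  map_mul' := W.lact_mul

theorem spectralRadius_lactL_le (a : R) : spectralRadius ℂ (W.lactL a) ≤ ‖a‖₊ := by
  refine iSup₂_le fun z hz => ?_
  have h1 := spectrum_subset_quasispectrum ℂ (W.lactL a) hz
  have h2 := NonUnitalAlgHom.quasispectrum_apply_subset W.lactHom a h1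
  rw [Unitization.quasispectrum_eq_spectrum_inr' ℂ ℂ] at h2
  have h3 := spectrum.norm_le_norm_of_mem h2
  rw [Unitization.norm_inr] at h3
  exact_mod_cast h3

theorem exists_norm_lactL_pow_le (a : R) {M : ℝ} (hM : ‖a‖ < M) :
    ∃ C, ∀ m : ℕ, ‖W.lactL a ^ m‖ ≤ C * M ^ m := by
  have hM0 : 0 < M := (norm_nonneg a).trans_lt hM
  have hlt : spectralRadius ℂ (W.lactL a) < ENNReal.ofReal M :=
    (W.spectralRadius_lactL_le a).trans_lt (by
      rw [← ENNReal.ofReal_coe_nnreal, coe_nnnorm]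
      exact (ENNReal.ofReal_lt_ofReal_iff hM0).2 hM)
  have hev := (spectrum.pow_nnnorm_pow_one_div_tendsto_nhds_spectralRadius
    (W.lactL a)).eventually_lt_const hlt
  have hev2 : ∀ᶠ m : ℕ in atTop, ‖W.lactL a ^ m‖ / M ^ m ≤ 1 := by
    filter_upwards [hev, eventually_gt_atTop 0] with m hm hm0
    rw [div_le_one (by positivity)]
    have h1 := ENNReal.rpow_le_rpow hm.le (z := m) (by positivity)
    rw [← ENNReal.rpow_mul, one_div, inv_mul_cancel₀ (by positivity), ENNReal.rpow_one,
      ENNReal.rpow_natCast, ← ENNReal.ofReal_pow hM0.le, ← ENNReal.ofReal_coe_nnreal,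
      coe_nnnorm] at h1
    exact (ENNReal.ofReal_le_ofReal_iff (by positivity)).1 h1
  have hb : IsBoundedUnder (· ≤ ·) atTop fun m : ℕ => ‖W.lactL a ^ m‖ / M ^ m :=
    ⟨1, eventually_map.2 hev2⟩
  obtain ⟨C, hC⟩ := hb.bddAbove_range
  exact ⟨C, fun m => (div_le_iff₀ (by positivity)).1 (hC ⟨m, rfl⟩)⟩

theorem norm_lactL_le_of_selfAdjoint {a : R} (ha : star a = a) (x : W.X) :
    ‖W.lactL a x‖ ≤ 4 * ‖x‖ * ‖a‖ := by
  have key : ∀ M, ‖a‖ < M → ‖W.lactL a x‖ ≤ 4 * ‖x‖ * M := by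
    intro M hM
    obtain ⟨C, hC⟩ := W.exists_norm_lactL_pow_le a hM
    refine W.isIp.norm_apply_le_of_growth (W.lactL a)
      (fun x y => by rw [W.lact_adjoint, ha]) x (C := C * ‖x‖)
      ((norm_nonneg a).trans_lt hM) fun m => ?_
    rw [← FunLike.coe_pow_eq_iterate]
    exact ((W.lactL a ^ m).le_opNorm x).trans
      ((mul_le_mul_of_nonneg_right (hC m) (norm_nonneg x)).trans_eq (by ring))
  have ht : Tendsto (fun M => 4 * ‖x‖ * M) (𝓝[>] ‖a‖) (𝓝 (4 * ‖x‖ * ‖a‖)) :=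
    ((continuous_const.mul continuous_id).tendsto _).mono_left nhdsWithin_le_nhds
  exact ge_of_tendsto ht (eventually_nhdsWithin_of_forall key)

theorem norm_lactL_apply_le (a : R) (x : W.X) : ‖W.lactL a x‖ ≤ 4 * ‖x‖ * ‖a‖ := by
  refine le_of_sq_le_sq ?_ (by positivity)
  rw [W.norm_eq, W.lact_adjoint, ← ContinuousLinearMap.comp_apply, ← W.lact_mul]
  calc _ ≤ 4 * ‖x‖ * ‖W.lactL (star a * a) x‖ := W.isIp.norm_le _ _
    _ ≤ 4 * ‖x‖ * (4 * ‖x‖ * ‖star a * a‖) := by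
        gcongr; exact W.norm_lactL_le_of_selfAdjoint (by simp) x
    _ = _ := by rw [CStarRing.norm_star_mul_self]; ring

/-- The left orbit map of a vector. -/
def lactCLM (x : W.X) : R →L[ℂ] W.X :=
  LinearMap.mkContinuous
    { toFun := fun a => W.lactL a x
      map_add' := fun a b => by rw [W.lact_add]; rfl
      map_smul' := fun c a => by rw [W.lact_smul]; rfl } (4 * ‖x‖)
    (fun a => W.norm_lactL_apply_le a x)

@[simp] theorem lactCLM_apply (x : W.X) (a : R) : W.lactCLM x a = W.lactL a x := rfl

theorem lactL_mul_apply (a b : R) (x : W.X) :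
    W.lactL (a * b) x = W.lactL a (W.lactL b x) := by
  rw [W.lact_mul]; rfl

theorem lactL_ract (a : R) (x : W.X) (b : R) :
    W.lactL a (W.ract x b) = W.ract (W.lactL a x) b := by
  refine W.isIp.ext_left fun z => ?_
  have h : ∀ y, W.inner z (W.lactL a y) = W.inner (W.lactL (star a) z) y := fun y => by
    rw [W.lact_adjoint, star_star]
  rw [h, W.inner_ract_right, W.inner_ract_right, h]

theorem eq_of_forall_ract {x y : W.X} (h : ∀ a, W.ract x a = W.ract y a) : x = y :=
  W.isIp.ext_left fun z => eq_of_forall_mul fun b => by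
    rw [← W.inner_ract_right, ← W.inner_ract_right, h]

end Corr

theorem mem_clspan_mul {R : Type u} [NonUnitalCStarAlgebra R] (a : R) :
    a ∈ clspan {b | ∃ e, b = a * e} := by
  refine closure_mono Submodule.subset_span (Metric.mem_closure_iff.2 fun ε hε => ?_)
  obtain ⟨e, -, he⟩ := exists_approx_unit a hε
  exact ⟨a * e, ⟨e, rfl⟩, by rwa [dist_eq_norm]⟩

theorem CorrIso.norm_toFun {R : Type u} [NonUnitalCStarAlgebra R] {W Z : Corr R}
    (f : CorrIso W Z) (x : W.X) : ‖f.toFun x‖ = ‖x‖ := by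
  rw [← sq_eq_sq₀ (norm_nonneg _) (norm_nonneg _), Z.norm_eq, f.map_inner, W.norm_eq]

/-- An isomorphism of correspondences as a continuous linear map. -/
def CorrIso.toCLM {R : Type u} [NonUnitalCStarAlgebra R] {W Z : Corr R}
    (f : CorrIso W Z) : W.X →L[ℂ] Z.X :=
  LinearMap.mkContinuous
    { toFun := f.toFun, map_add' := f.map_add, map_smul' := f.map_smul } 1
    (fun x => by simpa using (f.norm_toFun x).le)

@[simp] theorem CorrIso.toCLM_apply {R : Type u} [NonUnitalCStarAlgebra R] {W Z : Corr R}
    (f : CorrIso W Z) (x : W.X) : f.toCLM x = f.toFun x := rfl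

/-! ### Growth estimates on dense subspaces -/

theorem IsIp.norm_apply_le_of_mem_clspan {E R : Type*} [NormedAddCommGroup E] [NormedSpace ℂ E]
    [NonUnitalCStarAlgebra R] {ip : E → E → R} (h : IsIp R ip) (T : E →L[ℂ] E)
    (hT : ∀ x y, ip (T x) y = ip x (T y)) {s : Set E} {M : ℝ} (hM : 0 < M)
    (hs : ∀ x ∈ s, ∃ C, ∀ m, ‖T^[m] x‖ ≤ C * M ^ m) {x : E} (hx : x ∈ clspan s) :
    ‖T x‖ ≤ 4 * ‖x‖ * M := by
  have key : ∀ x ∈ Submodule.span ℂ s, ∃ C, ∀ m, ‖T^[m] x‖ ≤ C * M ^ m := by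
    intro x hx
    induction hx using Submodule.span_induction with
    | mem x hx => exact hs x hx
    | zero =>
      refine ⟨0, fun m => ?_⟩
      rw [← FunLike.coe_pow_eq_iterate]
      simp
    | add x y _ _ ihx ihy =>
      obtain ⟨C, hC⟩ := ihx
      obtain ⟨C', hC'⟩ := ihy
      refine ⟨C + C', fun m => ?_⟩
      have h1 := hC m
      have h2 := hC' m
      rw [← FunLike.coe_pow_eq_iterate] at *
      rw [map_add, add_mul]
      exact (norm_add_le _ _).trans (add_le_add h1 h2)
    | smul c x _ ihx =>
      obtain ⟨C, hC⟩ := ihx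
      refine ⟨‖c‖ * C, fun m => ?_⟩
      have h1 := hC m
      rw [← FunLike.coe_pow_eq_iterate] at *
      rw [map_smul, norm_smul, mul_assoc]
      gcongr
  have hcl : IsClosed {x : E | ‖T x‖ ≤ 4 * ‖x‖ * M} := isClosed_le (by fun_prop) (by fun_prop)
  refine closure_minimal (fun x hx => ?_) hcl hx
  obtain ⟨C, hC⟩ := key x hx
  exact h.norm_apply_le_of_growth T hT x hM hC

theorem IsIp.norm_adjoint_le {E R : Type*} [NormedAddCommGroup E] [NormedSpace ℂ E]
    [NonUnitalCStarAlgebra R] {ip : E → E → R} (h : IsIp R ip) (K : E →L[ℂ] E) (K' : E → E)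
    (hK : ∀ x y, ip (K' x) y = ip x (K y)) (x : E) : ‖K' x‖ ≤ 4 * ‖K‖ * ‖x‖ := by
  rcases eq_or_ne (K' x) 0 with h0 | h0
  · rw [h0, norm_zero]; positivity
  · have h1 : ‖K' x‖ * ‖K' x‖ ≤ 4 * ‖K‖ * ‖x‖ * ‖K' x‖ := by
      rw [← sq, h.norm_eq, hK]
      refine (h.norm_le _ _).trans ?_
      calc 4 * ‖x‖ * ‖K (K' x)‖ ≤ 4 * ‖x‖ * (‖K‖ * ‖K' x‖) := by gcongr; exact K.le_opNorm _
        _ = _ := by ring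
    exact le_of_mul_le_mul_right h1 (norm_pos_iff.2 h0)

/-! ### Representations and covariance -/

section Rep

variable {R S : Type u} [NonUnitalCStarAlgebra R] [NonUnitalCStarAlgebra S] {W : Corr R}
  {π : R → S} {t : W.X → S}

theorem IsRep.norm_le (h : IsRep W π t) (x : W.X) : ‖t x‖ ≤ ‖x‖ := by
  refine le_of_sq_le_sq ?_ (norm_nonneg _)
  rw [sq, ← CStarRing.norm_star_mul_self, h.inner, W.norm_eq]
  exact h.hom.norm_le _

/-- The vector part of a representation as a continuous linear map. -/
def IsRep.toCLM (h : IsRep W π t) : W.X →L[ℂ] S :=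
  LinearMap.mkContinuous
    { toFun := t, map_add' := h.t_add, map_smul' := h.t_smul } 1
    (fun x => by simpa using h.norm_le x)

@[simp] theorem IsRep.toCLM_apply (h : IsRep W π t) (x : W.X) : h.toCLM x = t x := rfl

theorem exists_sum_rankOne {T : W.X →L[ℂ] W.X}
    (hT : T ∈ Submodule.span ℂ {T : W.X →L[ℂ] W.X | ∃ x y, T = W.rankOne x y}) :
    ∃ (N : ℕ) (x y : Fin N → W.X), T = ∑ r, W.rankOne (x r) (y r) := by
  obtain ⟨N, f, g, rfl⟩ := Submodule.mem_span_set'.1 hT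
  choose x y hxy using fun i => (g i).2
  refine ⟨N, fun i => f i • x i, y, Finset.sum_congr rfl fun i _ => ?_⟩
  ext z
  rw [hxy, smul_apply, W.rankOne_apply, W.rankOne_apply, W.ract_smul]

theorem exists_tendsto_rankOne {T : W.X →L[ℂ] W.X}
    (hT : T ∈ closure (Submodule.span ℂ {T : W.X →L[ℂ] W.X | ∃ x y, T = W.rankOne x y} :
      Set (W.X →L[ℂ] W.X))) :
    ∃ (N : ℕ → ℕ) (x y : ∀ n, Fin (N n) → W.X),
      Tendsto (fun n => ∑ r, W.rankOne (x n r) (y n r)) atTop (𝓝 T) := by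
  obtain ⟨u, hu, hlim⟩ := mem_closure_iff_seq_limit.1 hT
  choose N x y hxy using fun n => exists_sum_rankOne (hu n)
  exact ⟨N, x, y, by simpa only [← hxy] using hlim⟩

theorem mem_clspan_of_covariant (hreg : W.Regular) (hc : CPCov W π t) (a : R) :
    π a ∈ clspan {b | ∃ x c, b = t x * c} := by
  obtain ⟨N, x, y, hxy⟩ := exists_tendsto_rankOne (hreg.2 a)
  refine (isClosed_clspan _).mem_of_tendsto (hc a N x y hxy) (Eventually.of_forall fun n => ?_)
  exact Submodule.sum_mem _ fun r _ => subset_clspan _ ⟨_, _, rfl⟩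

theorem IsRep.covariant_of_mem_clspan (h : IsRep W π t)
    (hd : ∀ a, π a ∈ clspan {b | ∃ x c, b = t x * c}) : CPCov W π t := by
  intro a N x y hlim
  set K : ℕ → W.X →L[ℂ] W.X := fun n => ∑ r, W.rankOne (x n r) (y n r) - W.lactL a with hK
  set K' : ℕ → W.X →L[ℂ] W.X := fun n =>
    ∑ r, W.rankOne (y n r) (x n r) - W.lactL (star a) with hK'
  set D : ℕ → S := fun n => ∑ r, t (x n r) * star (t (y n r)) - π a with hD
  have hDt : ∀ n z, D n * t z = t (K n z) := by
    intro n z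
    have h1 : t (K n z) = h.toCLM (K n z) := rfl
    rw [h1, hK, hD]
    simp only [sub_mul, Finset.sum_mul, sub_apply,
      sum_apply, map_sub, map_sum, IsRep.toCLM_apply, h.lact,
      W.rankOne_apply, h.ract, ← h.inner, mul_assoc]
  have hDt' : ∀ n z, star (D n) * t z = t (K' n z) := by
    intro n z
    have h1 : t (K' n z) = h.toCLM (K' n z) := rfl
    rw [h1, hK', hD]
    simp only [star_sub, star_sum, star_mul, star_star, sub_mul, Finset.sum_mul,
      sub_apply, sum_apply, map_sub, map_sum,
      IsRep.toCLM_apply, h.lact, W.rankOne_apply, h.ract, ← h.inner, mul_assoc, h.hom.map_star]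
  have hadj : ∀ n u v, W.inner (K' n u) v = W.inner u (K n v) := by
    intro n u v
    have hi := W.isIp
    rw [← W.inner_star, ← hi.rightCLM_apply v, ← hi.rightCLM_apply u, hK, hK']
    simp only [sub_apply, sum_apply, map_sub, map_sum, star_sub, star_sum]
    simp only [W.rankOne_apply, hi.rightCLM_apply, W.inner_ract_right, star_mul, W.inner_star]
    rw [W.lact_adjoint, star_star]
  have hb : ∀ n, ‖D n‖ ≤ 4 * ‖K n‖ := by
    intro n
    have hmem : D n ∈ clspan {b | ∃ x c, b = t x * c} :=
      Submodule.sub_mem _ (Submodule.sum_mem _ fun r _ => subset_clspan _ ⟨_, _, rfl⟩) (hd a)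
    rcases eq_or_ne (D n) 0 with h0 | h0
    · rw [h0, norm_zero]; positivity
    have key : ∀ M, 4 * ‖K n‖ ^ 2 < M → ‖D n‖ ^ 2 ≤ 4 * M := by
      intro M hM
      have hM0 : 0 < M := (by positivity : (0 : ℝ) ≤ 4 * ‖K n‖ ^ 2).trans_lt hM
      have h1 := (isIp_mul S).norm_apply_le_of_mem_clspan ((mulL (D n)).comp (mulL (star (D n))))
        (fun u v => by simp [mul_assoc]) hM0 (s := {b | ∃ x c, b = t x * c}) (by
          rintro _ ⟨z, c, rfl⟩
          refine ⟨‖z‖ * ‖c‖, fun m => ?_⟩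
          have hit : ∀ m, ((mulL (D n)).comp (mulL (star (D n))))^[m] (t z * c) =
              t ((fun u => K n (K' n u))^[m] z) * c := by
            intro m
            induction m with
            | zero => rfl
            | succ m ih =>
              rw [Function.iterate_succ_apply', ih, Function.iterate_succ_apply']
              simp only [ContinuousLinearMap.comp_apply, mulL_apply]
              rw [← mul_assoc (star _), hDt', ← mul_assoc, hDt]
          have hnm : ∀ m, ‖(fun u => K n (K' n u))^[m] z‖ ≤ ‖z‖ * M ^ m := by
            intro m
            induction m with
            | zero => simp
            | succ m ih =>
              rw [Function.iterate_succ_apply']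
              calc _ ≤ ‖K n‖ * ‖K' n ((fun u => K n (K' n u))^[m] z)‖ := (K n).le_opNorm _
                _ ≤ ‖K n‖ * (4 * ‖K n‖ * ‖(fun u => K n (K' n u))^[m] z‖) := by
                  gcongr; exact W.isIp.norm_adjoint_le (K n) (K' n) (hadj n) _
                _ = (4 * ‖K n‖ ^ 2) * ‖(fun u => K n (K' n u))^[m] z‖ := by ring
                _ ≤ M * (‖z‖ * M ^ m) := by
                  exact mul_le_mul hM.le ih (norm_nonneg _) hM0.le
                _ = _ := by ring
          rw [hit]
          calc _ ≤ ‖t ((fun u => K n (K' n u))^[m] z)‖ * ‖c‖ := norm_mul_le _ _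
            _ ≤ (‖z‖ * M ^ m) * ‖c‖ := by gcongr; exact (h.norm_le _).trans (hnm m)
            _ = _ := by ring) hmem
      simp only [ContinuousLinearMap.comp_apply, mulL_apply] at h1
      have h2 : ‖D n‖ ^ 4 ≤ ‖D n‖ * ‖D n * (star (D n) * D n)‖ := by
        have h3 : ‖star (star (D n) * D n) * (star (D n) * D n)‖ =
            ‖star (D n) * D n‖ * ‖star (D n) * D n‖ := CStarRing.norm_star_mul_self
        rw [star_mul, star_star, CStarRing.norm_star_mul_self, mul_assoc] at h3
        have h4 := norm_mul_le (star (D n)) (D n * (star (D n) * D n))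
        rw [h3, norm_star] at h4
        refine le_trans (le_of_eq ?_) h4
        ring
      have h0' : 0 < ‖D n‖ := norm_pos_iff.2 h0
      have h5 : ‖D n‖ ^ 2 * ‖D n‖ ^ 2 ≤ (4 * M) * ‖D n‖ ^ 2 := by
        calc ‖D n‖ ^ 2 * ‖D n‖ ^ 2 = ‖D n‖ ^ 4 := by ring
          _ ≤ _ := h2
          _ ≤ ‖D n‖ * (4 * ‖D n‖ * M) := by gcongr
          _ = _ := by ring
      exact le_of_mul_le_mul_right h5 (by positivity)
    have ht : Tendsto (fun M : ℝ => 4 * M) (𝓝[>] (4 * ‖K n‖ ^ 2)) (𝓝 (4 * (4 * ‖K n‖ ^ 2))) :=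
      ((continuous_const.mul continuous_id).tendsto _).mono_left nhdsWithin_le_nhds
    have h6 : ‖D n‖ ^ 2 ≤ 4 * (4 * ‖K n‖ ^ 2) :=
      ge_of_tendsto ht (eventually_nhdsWithin_of_forall key)
    refine le_of_sq_le_sq (h6.trans_eq (by ring)) (by positivity)
  have hK0 : Tendsto (fun n => 4 * ‖K n‖) atTop (𝓝 0) := by
    have := (tendsto_iff_norm_sub_tendsto_zero.1 hlim).const_mul 4
    simpa using this
  exact tendsto_iff_norm_sub_tendsto_zero.2 (squeeze_zero (fun n => norm_nonneg _) hb hK0)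

end Rep

/-! ### Representations of a generating system -/

theorem exists_tensor_rep {R S : Type u} [NonUnitalCStarAlgebra R] [NonUnitalCStarAlgebra S]
    {W V T : Corr R} {m : W.X → V.X → T.X} (hT : IsTensor W V T m) {π : R → S} {t : W.X → S}
    {s : V.X → S} (ht : IsRep W π t) (hs : IsRep V π s) :
    ∃ τ : T.X →L[ℂ] S, ∀ x y, τ (m x y) = t x * s y := by
  obtain ⟨τ, hτ, -⟩ := T.isIp.exists_clm (isIp_mul S) ht.hom.toCLM
    (fun p : W.X × V.X => m p.1 p.2) (fun p => t p.1 * s p.2)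
    (by convert hT.dense using 4; ext z; simp [eq_comm])
    (fun p q => by
      rw [hT.inner, IsStarHom.toCLM_apply, ← hs.inner, hs.lact, ← ht.inner, star_mul]
      simp only [mul_assoc])
  exact ⟨τ, fun x y => hτ (x, y)⟩

/-- A family of maps on `Y i`, `Y j` is compatible with the flip `θ i j`. -/
def Flips {k : ℕ} (G : GenSys A k) (σ : ∀ i, (G.Y i).X → B) (i j : Fin k) : Prop :=
  ∃ τ : (G.T j i).X →L[ℂ] B, (∀ y x, τ (G.tmul j i y x) = σ j y * σ i x) ∧
    ∀ x y, τ ((G.θ i j).toFun (G.tmul i j x y)) = σ i x * σ j y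

/-- A representation of a generating system. -/
structure GenRep {k : ℕ} (G : GenSys A k) (π : A → B) (σ : ∀ i, (G.Y i).X → B) : Prop where
  hom : IsStarHom π
  isRep : ∀ i, IsRep (G.Y i) π (σ i)
  flips : ∀ i j, Flips G σ i j

theorem Flips.symm {k : ℕ} {G : GenSys A k} {σ : ∀ i, (G.Y i).X → B} {i j : Fin k}
    (h : Flips G σ i j) : Flips G σ j i := by
  obtain ⟨τ, h1, h2⟩ := h
  exact ⟨τ.comp (G.θ i j).toCLM, h2, fun y x => by simp [G.θ_symm, h1]⟩

theorem GenRep.of_lt {k : ℕ} {G : GenSys A k} {π : A → B} {σ : ∀ i, (G.Y i).X → B}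
    (hom : IsStarHom π) (isRep : ∀ i, IsRep (G.Y i) π (σ i))
    (flips : ∀ i j, i < j → Flips G σ i j) : GenRep G π σ where
  hom := hom
  isRep := isRep
  flips i j := by
    rcases lt_trichotomy i j with h | rfl | h
    · exact flips i j h
    · obtain ⟨τ, hτ⟩ := exists_tensor_rep (G.isTensor i i) (isRep i) (isRep i)
      exact ⟨τ, hτ, fun x y => by rw [G.θ_diag, hτ]⟩
    · exact (flips j i h).symm

theorem GenRep.prod {k : ℕ} {G : GenSys A k} {B' : Type u} [NonUnitalCStarAlgebra B']
    {π : A → B} {σ : ∀ i, (G.Y i).X → B} {π' : A → B'} {σ' : ∀ i, (G.Y i).X → B'}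
    (h : GenRep G π σ) (h' : GenRep G π' σ') :
    GenRep G (fun a => (π a, π' a)) (fun i x => (σ i x, σ' i x)) := by
  have hom : IsStarHom fun a => (π a, π' a) :=
    ⟨fun a b => Prod.ext (h.hom.map_add a b) (h'.hom.map_add a b),
      fun a b => Prod.ext (h.hom.map_mul a b) (h'.hom.map_mul a b),
      fun a => Prod.ext (h.hom.map_star a) (h'.hom.map_star a),
      fun c a => Prod.ext (h.hom.map_smul c a) (h'.hom.map_smul c a)⟩
  refine ⟨hom, fun i => ?_, fun i j => ?_⟩
  · have h1 := h.isRep i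
    have h2 := h'.isRep i
    exact ⟨hom, fun a b => Prod.ext (h1.t_add a b) (h2.t_add a b),
      fun a b => Prod.ext (h1.t_smul a b) (h2.t_smul a b),
      fun a b => Prod.ext (h1.lact a b) (h2.lact a b),
      fun a b => Prod.ext (h1.ract a b) (h2.ract a b),
      fun a b => Prod.ext (h1.inner a b) (h2.inner a b)⟩
  · obtain ⟨τ, h1, h2⟩ := h.flips i j
    obtain ⟨τ', h1', h2'⟩ := h'.flips i j
    exact ⟨τ.prod τ', fun x y => Prod.ext (h1 x y) (h1' x y),
      fun x y => Prod.ext (h2 x y) (h2' x y)⟩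

section Words

variable {k : ℕ} {G : GenSys A k} {π : A → B} {σ : ∀ i, (G.Y i).X → B}

/-- The closed span of products `σ i₁ x₁ ⋯ σ iₙ xₙ π a` for a word `i₁ ⋯ iₙ`. -/
def GenRep.wordSpan (h : GenRep G π σ) : List (Fin k) → Submodule ℂ B
  | [] => (LinearMap.range (h.hom.toCLM : A →ₗ[ℂ] B)).topologicalClosure
  | i :: c => clspan {d | ∃ x, ∃ e ∈ h.wordSpan c, d = σ i x * e}

/-- The exponent of a word. -/
def wordDeg : List (Fin k) → (Fin k → ℕ)
  | [] => 0
  | i :: c => egen i + wordDeg c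

theorem wordDeg_append (c c' : List (Fin k)) : wordDeg (c ++ c') = wordDeg c + wordDeg c' := by
  induction c with
  | nil => simp [wordDeg]
  | cons i c ih => simp [wordDeg, ih, add_assoc]

theorem wordDeg_apply (c : List (Fin k)) (i : Fin k) : wordDeg c i = c.count i := by
  induction c with
  | nil => simp [wordDeg]
  | cons j c ih =>
    simp only [wordDeg, Pi.add_apply, ih, egen, Pi.single_apply, List.count_cons, beq_iff_eq]
    simp only [eq_comm, add_comm]

theorem perm_of_wordDeg_eq {c c' : List (Fin k)} (h : wordDeg c = wordDeg c') : c.Perm c' :=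
  List.perm_iff_count.2 fun i => by rw [← wordDeg_apply, h, wordDeg_apply]

theorem exists_wordDeg_eq (s : Fin k → ℕ) : ∃ c, wordDeg c = s := by
  have hsingle : ∀ (i : Fin k) (n : ℕ), ∃ c, wordDeg c = n • egen i := by
    intro i n
    refine ⟨List.replicate n i, ?_⟩
    induction n with
    | zero => simp [wordDeg]
    | succ n ih => rw [List.replicate_succ, wordDeg, ih, succ_nsmul']
  have hsum : ∀ u : Finset (Fin k), ∃ c, wordDeg c = ∑ i ∈ u, s i • egen i := by
    intro u
    induction u using Finset.induction_on with
    | empty => exact ⟨[], by simp [wordDeg]⟩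
    | insert i u hi ih =>
      obtain ⟨c, hc⟩ := ih
      obtain ⟨d, hd⟩ := hsingle i (s i)
      exact ⟨d ++ c, by rw [wordDeg_append, hc, hd, Finset.sum_insert hi]⟩
  obtain ⟨c, hc⟩ := hsum Finset.univ
  refine ⟨c, hc.trans ?_⟩
  ext j
  simp [Finset.sum_apply, egen, Pi.single_apply]

namespace GenRep

variable (h : GenRep G π σ)

theorem isClosed_wordSpan (c : List (Fin k)) : IsClosed (h.wordSpan c : Set B) := by
  cases c with
  | nil => exact Submodule.isClosed_topologicalClosure _
  | cons i c => exact isClosed_clspan _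

theorem pi_mem_wordSpan (a : A) : π a ∈ h.wordSpan [] :=
  Submodule.le_topologicalClosure _ ⟨a, rfl⟩

theorem mul_mem_wordSpan_cons {i : Fin k} {c : List (Fin k)} (x : (G.Y i).X) {e : B}
    (he : e ∈ h.wordSpan c) : σ i x * e ∈ h.wordSpan (i :: c) :=
  subset_clspan _ ⟨x, e, he, rfl⟩

theorem map_mem_of_mem_wordSpan_nil {E : Type*} [NormedAddCommGroup E] [NormedSpace ℂ E]
    (f : B →L[ℂ] E) {K : Submodule ℂ E} (hK : IsClosed (K : Set E)) (hf : ∀ a, f (π a) ∈ K)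
    {d : B} (hd : d ∈ h.wordSpan []) : f d ∈ K := by
  refine Submodule.topologicalClosure_minimal (t := K.comap (f : B →ₗ[ℂ] E)) _ ?_
    (hK.preimage f.continuous) hd
  rintro _ ⟨a, rfl⟩
  exact hf a

theorem pi_mul_mem (c : List (Fin k)) (a : A) {d : B} (hd : d ∈ h.wordSpan c) :
    π a * d ∈ h.wordSpan c := by
  cases c with
  | nil =>
    refine h.map_mem_of_mem_wordSpan_nil (mulL (π a)) (h.isClosed_wordSpan _) (fun b => ?_) hd
    rw [mulL_apply, ← h.hom.map_mul]
    exact h.pi_mem_wordSpan _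
  | cons i c =>
    refine map_mem_of_mem_clspan (mulL (π a)) (h.isClosed_wordSpan _) ?_ hd
    rintro _ ⟨x, e, he, rfl⟩
    rw [mulL_apply, ← mul_assoc, ← (h.isRep i).lact]
    exact h.mul_mem_wordSpan_cons _ he

theorem mul_mem_wordSpan (c c' : List (Fin k)) {d e : B} (hd : d ∈ h.wordSpan c)
    (he : e ∈ h.wordSpan c') : d * e ∈ h.wordSpan (c ++ c') := by
  induction c generalizing d with
  | nil =>
    exact h.map_mem_of_mem_wordSpan_nil (mulR e) (h.isClosed_wordSpan _)
      (fun a => h.pi_mul_mem c' a he) hd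
  | cons i c ih =>
    refine map_mem_of_mem_clspan (mulR e) (h.isClosed_wordSpan _) ?_ hd
    rintro _ ⟨x, f, hf, rfl⟩
    rw [mulR_apply, mul_assoc]
    exact h.mul_mem_wordSpan_cons _ (ih hf)

theorem star_mem_wordSpan_nil {d : B} (hd : d ∈ h.wordSpan []) : star d ∈ h.wordSpan [] := by
  refine (closure_minimal (t := star ⁻¹' (h.wordSpan [] : Set B)) ?_
    ((h.isClosed_wordSpan _).preimage continuous_star)) hd
  rintro _ ⟨a, rfl⟩
  change star (π a) ∈ h.wordSpan []
  rw [← h.hom.map_star]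
  exact h.pi_mem_wordSpan _

theorem star_mul_mem (c : List (Fin k)) {d e : B} (hd : d ∈ h.wordSpan c)
    (he : e ∈ h.wordSpan c) : star d * e ∈ h.wordSpan [] := by
  induction c generalizing d e with
  | nil => exact h.mul_mem_wordSpan [] [] (h.star_mem_wordSpan_nil hd) he
  | cons i c ih =>
    have key : ∀ x, ∀ f ∈ h.wordSpan c, ∀ e ∈ h.wordSpan (i :: c),
        star (σ i x * f) * e ∈ h.wordSpan [] := by
      intro x f hf e he
      refine map_mem_of_mem_clspan (mulL (star (σ i x * f))) (h.isClosed_wordSpan _) ?_ he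
      rintro _ ⟨y, g, hg, rfl⟩
      have : star (σ i x * f) * (σ i y * g) = star f * (π ((G.Y i).inner x y) * g) := by
        rw [← (h.isRep i).inner, star_mul]
        simp only [mul_assoc]
      rw [mulL_apply, this]
      exact ih hf (h.pi_mul_mem c _ hg)
    have h2 : star e * d ∈ h.wordSpan [] := by
      refine map_mem_of_mem_clspan (mulL (star e)) (h.isClosed_wordSpan _) ?_ hd
      rintro _ ⟨x, f, hf, rfl⟩
      have := h.star_mem_wordSpan_nil (key x f hf e he)
      rwa [star_mul, star_star] at this
    have := h.star_mem_wordSpan_nil h2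
    rwa [star_mul, star_star] at this

theorem wordSpan_swap_le (i j : Fin k) (c : List (Fin k)) :
    h.wordSpan (i :: j :: c) ≤ h.wordSpan (j :: i :: c) := by
  refine clspan_le (h.isClosed_wordSpan _) ?_
  rintro _ ⟨x, e, he, rfl⟩
  refine map_mem_of_mem_clspan (mulL (σ i x)) (h.isClosed_wordSpan _) ?_ he
  rintro _ ⟨y, f, hf, rfl⟩
  obtain ⟨τ, h1, h2⟩ := h.flips i j
  rw [mulL_apply, ← mul_assoc, ← h2]
  refine mem_of_dense_span ((mulR f).comp τ) (G.isTensor j i).dense (h.isClosed_wordSpan _) ?_ _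
  rintro _ ⟨z, w, rfl⟩
  rw [ContinuousLinearMap.comp_apply, h1, mulR_apply, mul_assoc]
  exact h.mul_mem_wordSpan_cons _ (h.mul_mem_wordSpan_cons _ hf)

theorem wordSpan_le_of_perm {c c' : List (Fin k)} (hc : c.Perm c') :
    h.wordSpan c ≤ h.wordSpan c' := by
  induction hc with
  | nil => exact le_rfl
  | cons i _ ih =>
    refine clspan_le (h.isClosed_wordSpan _) ?_
    rintro _ ⟨x, e, he, rfl⟩
    exact h.mul_mem_wordSpan_cons _ (ih he)
  | swap i j c => exact h.wordSpan_swap_le j i c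
  | trans _ _ ih ih' => exact ih.trans ih'

theorem sigma_mem_wordSpan (i : Fin k) (x : (G.Y i).X) : σ i x ∈ h.wordSpan [i] := by
  refine map_mem_of_mem_clspan (h.isRep i).toCLM (h.isClosed_wordSpan _) ?_
    ((G.Y i).mem_clspan_ract x)
  rintro _ ⟨a, rfl⟩
  rw [IsRep.toCLM_apply, (h.isRep i).ract]
  exact h.mul_mem_wordSpan_cons _ (h.pi_mem_wordSpan a)

end GenRep

end Words

/-! ### The universal property in terms of generators -/

section Universal

variable {k : ℕ} {G : GenSys A k} {Xs : PSys A k} (gen : Generates G Xs)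

theorem isRep_comp_corrIso {R S : Type u} [NonUnitalCStarAlgebra R] [NonUnitalCStarAlgebra S]
    {W Z : Corr R} (f : CorrIso W Z) {π : R → S} {t : Z.X → S} (h : IsRep Z π t) :
    IsRep W π fun x => t (f.toFun x) :=
  ⟨h.hom, fun x y => by rw [f.map_add, h.t_add], fun c x => by rw [f.map_smul, h.t_smul],
    fun a x => by rw [f.map_lact, h.lact], fun x a => by rw [f.map_ract, h.ract],
    fun x y => by rw [h.inner, f.map_inner]⟩

theorem PSRep.psi_heq {S : Type u} [NonUnitalCStarAlgebra S] (r : PSRep Xs S)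
    {s s' : Fin k → ℕ} (hs : s = s') {x : (Xs.fib s).X} {x' : (Xs.fib s').X} (hx : HEq x x') :
    r.ψ s x = r.ψ s' x' := by
  subst hs
  rw [eq_of_heq hx]

theorem PSRep.genRep {S : Type u} [NonUnitalCStarAlgebra S] (r : PSRep Xs S) :
    GenRep G r.π (fun i x => r.ψ (egen i) ((gen.ι i).toFun x)) where
  hom := (r.isRep 0).hom
  isRep i := isRep_comp_corrIso (gen.ι i) (r.isRep _)
  flips i j := by
    refine ⟨(r.isRep (egen j + egen i)).toCLM.comp (gen.κ j i).toCLM, fun y x => ?_,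
      fun x y => ?_⟩
    · simp [gen.κ_mul, r.mul]
    · rw [r.mul, ← gen.κ_mul]
      exact r.psi_heq (add_comm _ _) (gen.θ_compat i j _)

theorem PSRep.mem_clspan {S : Type u} [NonUnitalCStarAlgebra S] (r : PSRep Xs S)
    (hr : PSCPCov r) (i : Fin k) (a : A) :
    r.π a ∈ clspan {b | ∃ x c, b = r.ψ (egen i) ((gen.ι i).toFun x) * c} := by
  have := mem_clspan_of_covariant (Xs.reg (egen i)).2 (hr (egen i)) a
  convert this using 3
  ext b
  constructor
  · rintro ⟨x, c, rfl⟩; exact ⟨_, c, rfl⟩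
  · rintro ⟨x, c, rfl⟩; exact ⟨(gen.ι i).invFun x, c, by rw [(gen.ι i).right_inv]⟩

theorem exists_hom_of_genRep (C : PSCPAlg Xs) {π : A → B} {σ : ∀ i, (G.Y i).X → B}
    (h : GenRep G π σ) (hd : ∀ i a, π a ∈ clspan {b | ∃ x c, b = σ i x * c}) :
    ∃ f : C.O →⋆ₙₐ[ℂ] B, (∀ a, f (C.rep.π a) = π a) ∧
      ∀ i x, f (C.rep.ψ (egen i) ((gen.ι i).toFun x)) = σ i x := by
  have H := (C.rep.genRep gen).prod h
  have norm_nil : ∀ d ∈ H.wordSpan [], ‖d.2‖ ≤ ‖d.1‖ := by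
    intro d hd
    have hcl : IsClosed {d : C.O × B | ‖d.2‖ ≤ ‖d.1‖} := isClosed_le (by fun_prop) (by fun_prop)
    refine closure_minimal ?_ hcl hd
    rintro _ ⟨a, rfl⟩
    change ‖π a‖ ≤ ‖C.rep.π a‖
    rw [(C.rep.isRep 0).hom.norm_eq C.inj]
    exact h.hom.norm_le a
  have norm_word : ∀ c, ∀ d ∈ H.wordSpan c, ‖d.2‖ ≤ ‖d.1‖ := by
    intro c d hd
    have h1 := norm_nil _ (H.star_mul_mem c hd hd)
    rw [Prod.snd_mul, Prod.fst_mul, Prod.snd_star, Prod.fst_star, CStarRing.norm_star_mul_self,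
      CStarRing.norm_star_mul_self] at h1
    exact le_of_sq_le_sq (by simpa only [sq] using h1) (norm_nonneg _)
  have uniq : ∀ c u v v', (u, v) ∈ H.wordSpan c → (u, v') ∈ H.wordSpan c → v = v' := by
    intro c u v v' h1 h2
    have := norm_word c _ (Submodule.sub_mem _ h1 h2)
    simpa [sub_eq_zero] using this
  have ex : ∀ c (x : (Xs.fib (wordDeg c)).X), ∃ v, (C.rep.ψ _ x, v) ∈ H.wordSpan c := by
    intro c
    induction c with
    | nil =>
      intro x
      obtain ⟨a, rfl⟩ := Xs.unit_bij.2 x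
      refine ⟨π a, ?_⟩
      change (C.rep.ψ 0 (Xs.unit a), π a) ∈ _
      rw [C.rep.ψ_zero]
      exact H.pi_mem_wordSpan a
    | cons i c ih =>
      intro x
      have hdom := isClosed_domain_of_bound (H.wordSpan (i :: c)) (H.isClosed_wordSpan _) 1
        (fun d hd => by rw [one_mul]; exact norm_word _ d hd)
      have := mem_of_dense_span (C.rep.isRep (egen i + wordDeg c)).toCLM
        (Xs.isTensor (egen i) (wordDeg c)).dense hdom (by
          rintro _ ⟨y, z, rfl⟩
          obtain ⟨v, hv⟩ := ih z
          refine ⟨_, H.mul_mem_wordSpan_cons ((gen.ι i).invFun y) hv, ?_⟩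
          simp [(gen.ι i).right_inv, C.rep.mul]) x
      obtain ⟨⟨u, v⟩, hv, hu⟩ := this
      refine ⟨v, ?_⟩
      change u = C.rep.ψ _ x at hu
      subst hu
      exact hv
  have ex' : ∀ s (x : (Xs.fib s).X), ∃ v, ∀ c, wordDeg c = s →
      (C.rep.ψ _ x, v) ∈ H.wordSpan c := by
    intro s x
    obtain ⟨c, rfl⟩ := exists_wordDeg_eq s
    obtain ⟨v, hv⟩ := ex c x
    exact ⟨v, fun c' hc' => H.wordSpan_le_of_perm (perm_of_wordDeg_eq hc').symm hv⟩
  choose ψ hψ using ex'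
  have ψ_eq : ∀ s x c v, wordDeg c = s → (C.rep.ψ s x, v) ∈ H.wordSpan c → ψ s x = v :=
    fun s x c v hc hv => uniq c _ _ _ (hψ s x c hc) hv
  have ψ_rep : ∀ s, IsRep (Xs.fib s) π (ψ s) := by
    intro s
    obtain ⟨c, hc⟩ := exists_wordDeg_eq s
    have hr := C.rep.isRep s
    refine ⟨h.hom, fun x y => ψ_eq _ _ c _ hc ?_, fun z x => ψ_eq _ _ c _ hc ?_,
      fun a x => ψ_eq _ _ c _ hc ?_, fun x a => ψ_eq _ _ c _ hc ?_, fun x y => ?_⟩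
    · rw [hr.t_add]
      exact Submodule.add_mem _ (hψ s x c hc) (hψ s y c hc)
    · rw [hr.t_smul]
      exact Submodule.smul_mem _ z (hψ s x c hc)
    · rw [hr.lact]
      exact H.pi_mul_mem c a (hψ s x c hc)
    · rw [hr.ract]
      have := H.mul_mem_wordSpan c [] (hψ s x c hc) (H.pi_mem_wordSpan a)
      rwa [List.append_nil] at this
    · refine uniq [] (star (C.rep.ψ s x) * C.rep.ψ s y) _ _
        (H.star_mul_mem c (hψ s x c hc) (hψ s y c hc)) ?_
      rw [hr.inner]
      exact H.pi_mem_wordSpan _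
  let r : PSRep Xs B :=
    { π := π
      ψ := ψ
      isRep := ψ_rep
      ψ_zero := fun a => ψ_eq _ _ [] _ rfl (by rw [C.rep.ψ_zero]; exact H.pi_mem_wordSpan a)
      mul := fun s t x y => by
        obtain ⟨c, hc⟩ := exists_wordDeg_eq s
        obtain ⟨d, hd⟩ := exists_wordDeg_eq t
        refine (ψ_eq _ _ (c ++ d) _ (by rw [wordDeg_append, hc, hd]) ?_).symm
        rw [← C.rep.mul]
        exact H.mul_mem_wordSpan c d (hψ s x c hc) (hψ t y d hd) }
  have hgen : ∀ i x, ψ (egen i) ((gen.ι i).toFun x) = σ i x := fun i x =>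
    ψ_eq _ _ [i] _ (by simp [wordDeg]) (H.sigma_mem_wordSpan i x)
  have hdens : ∀ c a, π a ∈ clspan {b | ∃ x e, b = ψ (wordDeg c) x * e} := by
    intro c
    induction c with
    | nil =>
      intro a
      refine clspan_le (isClosed_clspan _) ?_ (mem_clspan_mul (π a))
      rintro _ ⟨e, rfl⟩
      exact subset_clspan _ ⟨Xs.unit a, e, by
        change _ = r.ψ 0 _ * e; rw [r.ψ_zero]⟩
    | cons i c ih =>
      intro a
      refine clspan_le (isClosed_clspan _) ?_ (hd i a)
      rintro _ ⟨y, e, rfl⟩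
      refine map_mem_of_mem_clspan ((mulR e).comp (h.isRep i).toCLM) (isClosed_clspan _) ?_
        ((G.Y i).mem_clspan_ract y)
      rintro _ ⟨b, rfl⟩
      rw [ContinuousLinearMap.comp_apply, IsRep.toCLM_apply, (h.isRep i).ract]
      refine map_mem_of_mem_clspan ((mulR e).comp (mulL (σ i y))) (isClosed_clspan _) ?_ (ih b)
      rintro _ ⟨x, f, rfl⟩
      refine subset_clspan _ ⟨Xs.mul _ _ ((gen.ι i).toFun y) x, f * e, ?_⟩
      change _ = r.ψ (egen i + wordDeg c) _ * _
      rw [← r.mul]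
      change _ = ψ _ _ * ψ _ _ * _
      simp [hgen, mul_assoc]
  have hcov : PSCPCov r := by
    intro s
    obtain ⟨c, rfl⟩ := exists_wordDeg_eq s
    exact (ψ_rep _).covariant_of_mem_clspan (hdens c)
  obtain ⟨f, ⟨hf1, hf2⟩, -⟩ := C.universal B r hcov
  exact ⟨f, hf1, fun i x => (hf2 _ _).trans (hgen i x)⟩

end Universal

/-! ### Generation and nondegeneracy -/

theorem CPAlg.mem_of_generators {R : Type u} [NonUnitalCStarAlgebra R] {W : Corr R} (C : CPAlg W)
    (K : NonUnitalStarSubalgebra ℂ C.O) (hK : IsClosed (K : Set C.O)) (hπ : ∀ a, C.π a ∈ K)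
    (ht : ∀ x, C.t x ∈ K) (z : C.O) : z ∈ K :=
  C.gen K hK hπ ht (fun _ _ => add_mem) (fun _ _ => mul_mem) (fun c _ hp => K.smul_mem' c hp)
    (fun _ => star_mem) z

section

variable {k : ℕ} {G : GenSys A k} {Xs : PSys A k}

theorem PSCPAlg.mem_of_generators (gen : Generates G Xs) (C : PSCPAlg Xs)
    (K : NonUnitalStarSubalgebra ℂ C.O) (hK : IsClosed (K : Set C.O)) (hπ : ∀ a, C.rep.π a ∈ K)
    (hσ : ∀ i x, C.rep.ψ (egen i) ((gen.ι i).toFun x) ∈ K) (z : C.O) : z ∈ K := by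
  have hψ : ∀ c (x : (Xs.fib (wordDeg c)).X), C.rep.ψ _ x ∈ K := by
    intro c
    induction c with
    | nil =>
      intro x
      obtain ⟨a, rfl⟩ := Xs.unit_bij.2 x
      change C.rep.ψ 0 (Xs.unit a) ∈ K
      rw [C.rep.ψ_zero]
      exact hπ a
    | cons i c ih =>
      refine mem_of_dense_span (C.rep.isRep (egen i + wordDeg c)).toCLM (K := K.toSubmodule)
        (Xs.isTensor (egen i) (wordDeg c)).dense hK ?_
      rintro _ ⟨y, z, rfl⟩
      rw [IsRep.toCLM_apply, ← C.rep.mul, ← (gen.ι i).right_inv y]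
      exact K.mul_mem (hσ i _) (ih z)
  refine C.gen K hK hπ (fun s x => ?_) (fun _ _ => add_mem) (fun _ _ => mul_mem)
    (fun c _ hp => K.smul_mem' c hp) (fun _ => star_mem) z
  obtain ⟨c, rfl⟩ := exists_wordDeg_eq s
  exact hψ c x

/-- Two *-homomorphisms agreeing on the generators are equal. -/
theorem PSCPAlg.hom_ext (gen : Generates G Xs) (C : PSCPAlg Xs) {f g : C.O →⋆ₙₐ[ℂ] B}
    (hπ : ∀ a, f (C.rep.π a) = g (C.rep.π a))
    (hσ : ∀ i x, f (C.rep.ψ (egen i) ((gen.ι i).toFun x)) =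
      g (C.rep.ψ (egen i) ((gen.ι i).toFun x))) (z : C.O) : f z = g z :=
  C.mem_of_generators gen (NonUnitalStarAlgHom.equalizer f g)
    (isClosed_eq (homCLM f).continuous (homCLM g).continuous) hπ hσ z

theorem PSCPAlg.mem_clspan_pi_mul (C : PSCPAlg Xs) (z : C.O) :
    z ∈ clspan {b | ∃ a c, b = C.rep.π a * c} := by
  set N := clspan {b | ∃ a c, b = C.rep.π a * c} with hN
  have hcl : IsClosed (N : Set C.O) := isClosed_clspan _
  have hmul : ∀ p ∈ N, ∀ q, p * q ∈ N := fun p hp q =>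
    map_mem_of_mem_clspan (mulR q) hcl
      (by rintro _ ⟨a, c, rfl⟩; exact subset_clspan _ ⟨a, c * q, by simp [mul_assoc]⟩) hp
  have hπ : ∀ a, C.rep.π a ∈ N := fun a =>
    clspan_le hcl (by rintro _ ⟨e, rfl⟩; exact subset_clspan _ ⟨a, e, rfl⟩)
      (mem_clspan_mul (C.rep.π a))
  refine (C.gen {z | z ∈ N ∧ star z ∈ N}
    (hcl.inter (hcl.preimage continuous_star)) (fun a => ⟨hπ a, ?_⟩) (fun s x => ⟨?_, ?_⟩)
    (fun p q hp hq => ⟨add_mem hp.1 hq.1, by rw [star_add]; exact add_mem hp.2 hq.2⟩)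
    (fun p q hp hq => ⟨hmul p hp.1 q, by rw [star_mul]; exact hmul _ hq.2 _⟩)
    (fun c p hp => ⟨N.smul_mem c hp.1, by rw [star_smul]; exact N.smul_mem _ hp.2⟩)
    (fun p hp => ⟨hp.2, by rw [star_star]; exact hp.1⟩) z).1
  · rw [← (C.rep.isRep 0).hom.map_star]
    exact hπ _
  · refine mem_of_dense_span (C.rep.isRep s).toCLM (Xs.reg s).1 hcl ?_ x
    rintro _ ⟨a, y, rfl⟩
    exact subset_clspan _ ⟨a, _, (C.rep.isRep s).lact a y⟩
  · have h1 : C.rep.ψ s x ∈ clspan {b | ∃ a, b = C.rep.ψ s ((Xs.fib s).ract x a)} :=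
      map_mem_of_mem_clspan (C.rep.isRep s).toCLM (isClosed_clspan _)
        (by rintro _ ⟨a, rfl⟩; exact subset_clspan _ ⟨a, rfl⟩) ((Xs.fib s).mem_clspan_ract x)
    have h2 : IsClosed {b : C.O | star b ∈ N} := hcl.preimage continuous_star
    refine closure_minimal ?_ h2 h1
    intro b hb
    induction hb using Submodule.span_induction with
    | mem b hb =>
      obtain ⟨a, rfl⟩ := hb
      rw [(C.rep.isRep s).ract, Set.mem_ofPred_eq, star_mul, ← (C.rep.isRep s).hom.map_star]
      exact subset_clspan _ ⟨_, _, rfl⟩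
    | zero => simp
    | add x y _ _ hx hy => rw [Set.mem_ofPred_eq, star_add]; exact add_mem hx hy
    | smul c x _ hx => rw [Set.mem_ofPred_eq, star_smul]; exact N.smul_mem _ hx

end

theorem CPAlg.hom_ext {R : Type u} [NonUnitalCStarAlgebra R] {W : Corr R} (C : CPAlg W)
    {f g : C.O →⋆ₙₐ[ℂ] B} (hπ : ∀ a, f (C.π a) = g (C.π a)) (ht : ∀ x, f (C.t x) = g (C.t x))
    (z : C.O) : f z = g z :=
  C.mem_of_generators (NonUnitalStarAlgHom.equalizer f g)
    (isClosed_eq (homCLM f).continuous (homCLM g).continuous) hπ ht z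

/-! ### Modules induced along a *-homomorphism -/

namespace MixedMod

variable {O : Type u} [NonUnitalCStarAlgebra O] {πA : A → O} {Y : Corr A} {Z : Corr O}
  {mm : Y.X → O → Z.X}

theorem norm_le (h : MixedMod Y O πA Z mm) (hπ : IsStarHom πA) (x : Y.X) (S : O) :
    ‖mm x S‖ ≤ ‖x‖ * ‖S‖ := by
  refine le_of_sq_le_sq ?_ (by positivity)
  rw [Z.norm_eq, h.inner, mul_pow, Y.norm_eq]
  calc _ ≤ ‖star S‖ * (‖πA (Y.inner x x)‖ * ‖S‖) :=
        (norm_mul_le _ _).trans (by gcongr; exact norm_mul_le _ _)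
    _ ≤ ‖star S‖ * (‖Y.inner x x‖ * ‖S‖) := by gcongr; exact hπ.norm_le _
    _ = _ := by rw [norm_star]; ring

/-- `x ↦ x ⊗ S` as a continuous linear map. -/
def leftCLM (h : MixedMod Y O πA Z mm) (hπ : IsStarHom πA) (S : O) : Y.X →L[ℂ] Z.X :=
  LinearMap.mkContinuous
    { toFun := fun x => mm x S
      map_add' := fun x y => h.add_left x y S
      map_smul' := fun c x => h.smul_left c x S } ‖S‖
    (fun x => (h.norm_le hπ x S).trans_eq (mul_comm _ _))

@[simp] theorem leftCLM_apply (h : MixedMod Y O πA Z mm) (hπ : IsStarHom πA) (S : O) (x : Y.X) :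
    h.leftCLM hπ S x = mm x S := rfl

/-- `S ↦ x ⊗ S` as a continuous linear map. -/
def rightCLM (h : MixedMod Y O πA Z mm) (hπ : IsStarHom πA) (x : Y.X) : O →L[ℂ] Z.X :=
  LinearMap.mkContinuous
    { toFun := mm x
      map_add' := h.add_right x
      map_smul' := fun c S => h.smul_right c x S } ‖x‖ (h.norm_le hπ x)

@[simp] theorem rightCLM_apply (h : MixedMod Y O πA Z mm) (hπ : IsStarHom πA) (S : O) (x : Y.X) :
    h.rightCLM hπ x S = mm x S := rfl

theorem dense_range (h : MixedMod Y O πA Z mm) :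
    closure (Submodule.span ℂ (Set.range fun p : Y.X × O => mm p.1 p.2) : Set Z.X) =
      Set.univ := by
  convert h.dense using 4
  ext z
  simp [eq_comm]

/-- The map `x ↦ x ⊗ 1`. -/
theorem exists_tensor_one (h : MixedMod Y O πA Z mm) (hπ : IsStarHom πA) :
    ∃ ξ : Y.X →L[ℂ] Z.X, (∀ x S, Z.ract (ξ x) S = mm x S) ∧
      (∀ x a, ξ (Y.ract x a) = mm x (πA a)) ∧ ∀ x y, Z.inner (ξ x) (ξ y) = πA (Y.inner x y) := by
  have hdense : closure (Submodule.span ℂ (Set.range fun p : Y.X × A => Y.ract p.1 p.2) :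
      Set Y.X) = Set.univ := by
    refine Set.eq_univ_of_forall fun x => ?_
    refine closure_mono (Submodule.span_mono ?_) (Y.mem_clspan_ract x)
    rintro _ ⟨a, rfl⟩
    exact ⟨(x, a), rfl⟩
  obtain ⟨ξ, hξ, hip⟩ := Y.isIp.exists_clm Z.isIp hπ.toCLM
    (fun p : Y.X × A => Y.ract p.1 p.2) (fun p => mm p.1 (πA p.2)) hdense (fun p q => by
      rw [h.inner, IsStarHom.toCLM_apply, Y.inner_ract_left, Y.inner_ract_right, hπ.map_mul,
        hπ.map_mul, hπ.map_star])
  refine ⟨ξ, fun x S => ?_, fun x a => hξ (x, a), hip⟩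
  refine eq_of_dense_span (f := (Z.ractCLM S).comp ξ) (g := h.leftCLM hπ S) hdense ?_ x
  rintro _ ⟨⟨y, a⟩, rfl⟩
  simp only [ContinuousLinearMap.comp_apply, Corr.ractCLM_apply, leftCLM_apply]
  rw [hξ (y, a), h.ract, h.balanced]

/-- Extension of a representation of `Y` to the induced module. -/
theorem exists_extension (h : MixedMod Y O πA Z mm) (ρ : O →⋆ₙₐ[ℂ] B) {κ : Y.X → B}
    (hκ : IsRep Y (fun a => ρ (πA a)) κ) :
    ∃ t : Z.X →L[ℂ] B, (∀ x S, t (mm x S) = κ x * ρ S) ∧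
      (∀ z w, star (t z) * t w = ρ (Z.inner z w)) ∧ ∀ z S, t (Z.ract z S) = t z * ρ S := by
  obtain ⟨t, ht, hip⟩ := Z.isIp.exists_clm (isIp_mul B) (homCLM ρ)
    (fun p : Y.X × O => mm p.1 p.2) (fun p => κ p.1 * ρ p.2) h.dense_range (fun p q => by
      rw [h.inner, homCLM_apply, map_mul, map_mul, ← hκ.inner, star_mul, map_star]
      simp only [mul_assoc])
  refine ⟨t, fun x S => ht (x, S), hip, fun z S => ?_⟩
  refine eq_of_dense_span (f := t.comp (Z.ractCLM S)) (g := (mulR (ρ S)).comp t)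
    h.dense ?_ z
  rintro _ ⟨x, T, rfl⟩
  simp only [ContinuousLinearMap.comp_apply, Corr.ractCLM_apply, mulR_apply, h.ract]
  rw [ht (x, T * S), ht (x, T), map_mul, mul_assoc]

end MixedMod

/-! ### Intertwiners and the representation of the induced module -/

theorem exists_intertwiner_subalgebra {R S : Type u} [NonUnitalCStarAlgebra R]
    [NonUnitalCStarAlgebra S] (W : Corr R) {F : Type*} [NormedAddCommGroup F] [NormedSpace ℂ F]
    {ip : F → F → S} (hip : IsIp S ip) (φ : W.X →L[ℂ] F) (Φ : R → S)
    (hφ : ∀ x y, ip (φ x) (φ y) = Φ (W.inner x y)) (L : R → F → F)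
    (hadd : ∀ a b x, L (a + b) x = L a x + L b x) (hmul : ∀ a b x, L (a * b) x = L a (L b x))
    (hsmul : ∀ (c : ℂ) a x, L (c • a) x = c • L a x) (hcont : ∀ x, Continuous fun a => L a x)
    (hadj : ∀ a x y, ip (L a x) y = ip x (L (star a) y))
    (hsep : ∀ d, (∀ w, ip (φ w) d = 0) → d = 0) :
    ∃ K : NonUnitalStarSubalgebra ℂ R, IsClosed (K : Set R) ∧
      ∀ a, a ∈ K ↔ ∀ w, φ (W.lactL a w) = L a (φ w) := by
  refine ⟨{ carrier := {a | ∀ w, φ (W.lactL a w) = L a (φ w)}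
            add_mem' := fun {a b} ha hb w => ?_
            zero_mem' := fun w => ?_
            mul_mem' := fun {a b} ha hb w => ?_
            smul_mem' := fun c a ha w => ?_
            star_mem' := fun {a} ha w => ?_ }, ?_, fun a => Iff.rfl⟩
  · rw [W.lact_add, add_apply, map_add, ha, hb, hadd]
  · have h1 := hsmul 0 0 (φ w)
    have h2 := W.lact_smul 0 0
    simp only [zero_smul] at h1 h2
    rw [h1, h2]
    simp
  · rw [W.lactL_mul_apply, ha, hb, hmul]
  · rw [W.lact_smul, smul_apply, map_smul, ha, hsmul]
  · refine sub_eq_zero.1 (hsep _ fun z => ?_)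
    have h1 : φ (W.lactL a z) = L a (φ z) := ha z
    rw [← hip.rightCLM_apply, map_sub, hip.rightCLM_apply, hip.rightCLM_apply, ← hadj, ← h1,
      hφ, hφ, W.lact_adjoint, sub_self]
  · have : {a | ∀ w, φ (W.lactL a w) = L a (φ w)} =
        ⋂ w, {a | φ (W.lactL a w) = L a (φ w)} := by ext; simp
    change IsClosed {a | ∀ w, φ (W.lactL a w) = L a (φ w)}
    rw [this]
    exact isClosed_iInter fun w =>
      isClosed_eq (φ.continuous.comp (W.lactCLM w).continuous) (hcont _)

section EPRep

variable {n : ℕ} {G : GenSys A n} {m : ℕ} {hm : m ≤ n} {Xs : PSys A m}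
  {gen : Generates (G.restrict m hm) Xs} {C : PSCPAlg Xs} {p : Fin n} {Z : Corr C.O}
  {mm : (G.Y p).X → C.O → Z.X}

theorem EPCorr.exists_isRep (hZ : EPCorr G hm Xs gen C p Z mm) (ρ : C.O →⋆ₙₐ[ℂ] B)
    {κ : (G.Y p).X → B} (hκ : IsRep (G.Y p) (fun a => ρ (C.rep.π a)) κ)
    (hfull : ∀ d : B, d ∈ clspan {b | ∃ x c, b = κ x * c})
    (hflip : ∀ i : Fin m, ∃ τ : (G.T p (Fin.castLE hm i)).X →L[ℂ] B,
      (∀ y x, τ (G.tmul p (Fin.castLE hm i) y x) =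
        κ y * ρ (C.rep.ψ (egen i) ((gen.ι i).toFun x))) ∧
      ∀ x y, τ ((G.θ (Fin.castLE hm i) p).toFun (G.tmul (Fin.castLE hm i) p x y)) =
        ρ (C.rep.ψ (egen i) ((gen.ι i).toFun x)) * κ y) :
    ∃ t : Z.X →L[ℂ] B, IsRep Z ρ t ∧ CPCov Z ρ t ∧ (∀ x S, t (mm x S) = κ x * ρ S) := by
  have hπ : IsStarHom C.rep.π := (C.rep.isRep 0).hom
  obtain ⟨t, ht, hip, hract⟩ := hZ.mod.exists_extension ρ hκ
  have hκ_mem : ∀ x c, κ x * c ∈ clspan {b | ∃ z c, b = t z * c} := by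
    intro x c
    refine map_mem_of_mem_clspan ((mulR c).comp hκ.toCLM) (isClosed_clspan _) ?_
      ((G.Y p).mem_clspan_ract x)
    rintro _ ⟨a, rfl⟩
    rw [ContinuousLinearMap.comp_apply, IsRep.toCLM_apply, hκ.ract, ← ht]
    exact subset_clspan _ ⟨_, c, rfl⟩
  have hfull' : ∀ d : B, d ∈ clspan {b | ∃ z c, b = t z * c} := fun d =>
    clspan_le (isClosed_clspan _) (by rintro _ ⟨x, c, rfl⟩; exact hκ_mem x c) (hfull d)
  have hsep : ∀ d : B, (∀ w, star (t w) * d = 0) → d = 0 := by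
    intro d hd
    have h1 : star d * d = 0 := by
      refine map_mem_of_mem_clspan (mulL (star d)) (K := ⊥) isClosed_singleton ?_ (hfull' d)
      rintro _ ⟨z, c, rfl⟩
      have h2 : star d * t z = 0 := by rw [← star_star (star d * t z), star_mul, star_star, hd,
        star_zero]
      rw [mulL_apply, ← mul_assoc, h2, zero_mul]
      exact Submodule.zero_mem _
    exact CStarRing.star_mul_self_eq_zero_iff d |>.1 h1
  obtain ⟨K, hK, hmem⟩ := exists_intertwiner_subalgebra Z (isIp_mul B) t ρ hip
    (fun a b => ρ a * b) (fun a b x => by rw [map_add, add_mul])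
    (fun a b x => by rw [map_mul, mul_assoc]) (fun c a x => by rw [map_smul, smul_mul_assoc])
    (fun x => (mulR x).continuous.comp (homCLM ρ).continuous)
    (fun a x y => by rw [star_mul, map_star, mul_assoc]) hsep
  have hall := C.mem_of_generators gen K hK
    (fun a => (hmem _).2 fun z => by
      refine eq_of_dense_span (f := t.comp (Z.lactL _)) (g := (mulL (ρ (C.rep.π a))).comp t)
        hZ.mod.dense ?_ z
      rintro _ ⟨y, S, rfl⟩
      rw [ContinuousLinearMap.comp_apply, hZ.lact_pi, ht, ContinuousLinearMap.comp_apply,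
        mulL_apply, ht, hκ.lact, mul_assoc])
    (fun i x => (hmem _).2 fun z => by
      obtain ⟨μ, hμ, hμ1, hμ2⟩ := hZ.lact_t i
      obtain ⟨τ, hτ1, hτ2⟩ := hflip i
      have key : ∀ S u, t (μ u S) = τ u * ρ S := fun S u => by
        refine eq_of_dense_span (f := t.comp (hμ S).toCLM) (g := (mulR (ρ S)).comp τ)
          (G.isTensor p (Fin.castLE hm i)).dense ?_ u
        rintro _ ⟨y, v, rfl⟩
        change t (μ _ S) = τ _ * ρ S
        rw [hμ1, ht, hτ1, map_mul, mul_assoc]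
      refine eq_of_dense_span (f := t.comp (Z.lactL _)) (g := (mulL (ρ _)).comp t)
        hZ.mod.dense ?_ z
      rintro _ ⟨y, S, rfl⟩
      rw [ContinuousLinearMap.comp_apply]
      refine (congrArg t (hμ2 x y S)).trans ?_
      refine (key S _).trans ((congrArg (· * ρ S) (hτ2 x y)).trans ?_)
      rw [ContinuousLinearMap.comp_apply, mulL_apply, ht, ← mul_assoc])
  have hrep : IsRep Z ρ t :=
    ⟨⟨map_add ρ, map_mul ρ, map_star ρ, map_smul ρ⟩, map_add t, map_smul t,
      fun a => (hmem a).1 (hall a), hract, hip⟩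
  exact ⟨t, hrep, hrep.covariant_of_mem_clspan fun a => hfull' _, ht⟩

end EPRep

/-! ### Compactness of the induced left action -/

namespace MixedMod

variable {O : Type u} [NonUnitalCStarAlgebra O] {πA : A → O} {Y : Corr A} {Z : Corr O}
  {mm : Y.X → O → Z.X}

theorem norm_le_of_intertwines (h : MixedMod Y O πA Z mm) (hπ : IsStarHom πA)
    (K K' : Y.X →L[ℂ] Y.X) (L L' : Z.X →L[ℂ] Z.X)
    (hK : ∀ x y, Y.inner (K' x) y = Y.inner x (K y))
    (hL : ∀ x y, Z.inner (L' x) y = Z.inner x (L y)) (h1 : ∀ x S, L (mm x S) = mm (K x) S)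
    (h2 : ∀ x S, L' (mm x S) = mm (K' x) S) : ‖L‖ ≤ 8 * ‖K‖ := by
  have hL' : ∀ x y, Z.inner (L x) y = Z.inner x (L' y) := fun x y => by
    rw [← Z.inner_star, ← hL, Z.inner_star]
  refine L.opNorm_le_bound (by positivity) fun z => ?_
  have key : ∀ M, 4 * ‖K‖ ^ 2 < M → ‖L z‖ ^ 2 ≤ (4 * ‖z‖) ^ 2 * M := by
    intro M hM
    have hM0 : 0 < M := (by positivity : (0 : ℝ) ≤ 4 * ‖K‖ ^ 2).trans_lt hM
    have hg := Z.isIp.norm_apply_le_of_mem_clspan (L'.comp L)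
      (fun u v => by simp only [ContinuousLinearMap.comp_apply]; rw [hL, ← hL']) hM0
      (s := {z | ∃ x S, z = mm x S}) (by
        rintro _ ⟨x, S, rfl⟩
        refine ⟨‖x‖ * ‖S‖, fun m => ?_⟩
        have hit : ∀ m, (L'.comp L)^[m] (mm x S) = mm ((fun y => K' (K y))^[m] x) S := by
          intro m
          induction m with
          | zero => rfl
          | succ m ih =>
            rw [Function.iterate_succ_apply', ih, Function.iterate_succ_apply',
              ContinuousLinearMap.comp_apply, h1, h2]
        have hnm : ∀ m, ‖(fun y => K' (K y))^[m] x‖ ≤ ‖x‖ * M ^ m := by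
          intro m
          induction m with
          | zero => simp
          | succ m ih =>
            rw [Function.iterate_succ_apply']
            set w := (fun y => K' (K y))^[m] x
            calc _ ≤ 4 * ‖K‖ * ‖K w‖ := Y.isIp.norm_adjoint_le K K' hK _
              _ ≤ 4 * ‖K‖ * (‖K‖ * ‖w‖) := by gcongr; exact K.le_opNorm _
              _ = (4 * ‖K‖ ^ 2) * ‖w‖ := by ring
              _ ≤ M * (‖x‖ * M ^ m) := mul_le_mul hM.le ih (norm_nonneg _) hM0.le
              _ = _ := by ring
        rw [hit]
        calc _ ≤ ‖(fun y => K' (K y))^[m] x‖ * ‖S‖ := h.norm_le hπ _ _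
          _ ≤ (‖x‖ * M ^ m) * ‖S‖ := by gcongr; exact hnm m
          _ = _ := by ring) (x := z) (by rw [clspan_eq_top h.dense]; trivial)
    rw [Z.norm_eq, hL']
    calc _ ≤ 4 * ‖z‖ * ‖L' (L z)‖ := Z.isIp.norm_le _ _
      _ ≤ 4 * ‖z‖ * (4 * ‖z‖ * M) := by gcongr; exact hg
      _ = _ := by ring
  have ht : Tendsto (fun M : ℝ => (4 * ‖z‖) ^ 2 * M) (𝓝[>] (4 * ‖K‖ ^ 2))
      (𝓝 ((4 * ‖z‖) ^ 2 * (4 * ‖K‖ ^ 2))) :=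
    ((continuous_const.mul continuous_id).tendsto _).mono_left nhdsWithin_le_nhds
  have h6 := ge_of_tendsto ht (eventually_nhdsWithin_of_forall key)
  exact le_of_sq_le_sq (h6.trans_eq (by ring)) (by positivity)

theorem mem_clspan_of_regular (h : MixedMod Y O πA Z mm) (hπ : IsStarHom πA)
    (hlact : ∀ a y S, Z.lactL (πA a) (mm y S) = mm (Y.lactL a y) S) (hreg : Y.Regular)
    (C : CPAlg Z) {ξ : Y.X →L[ℂ] Z.X} (hξ : ∀ x S, Z.ract (ξ x) S = mm x S)
    (hip : ∀ x y, Z.inner (ξ x) (ξ y) = πA (Y.inner x y)) (a : A) :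
    C.π (πA a) ∈ clspan {b | ∃ x c, b = C.t (ξ x) * c} := by
  obtain ⟨N, x, y, hxy⟩ := exists_tendsto_rankOne (hreg.2 a)
  have hrank : ∀ u v w S, Z.rankOne (ξ u) (ξ v) (mm w S) = mm (Y.rankOne u v w) S := by
    intro u v w S
    rw [Z.rankOne_apply, Y.rankOne_apply, ← hξ w, Z.inner_ract_right, hip, Z.ract_mul, hξ, h.ract,
      h.balanced]
  have hsum : ∀ {M : ℕ} (u v : Fin M → Y.X) (b : A) w S,
      (∑ r, Z.rankOne (ξ (u r)) (ξ (v r)) - Z.lactL (πA b)) (mm w S) =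
        mm ((∑ r, Y.rankOne (u r) (v r) - Y.lactL b) w) S := by
    intro M u v b w S
    rw [← h.leftCLM_apply hπ S ((∑ r, Y.rankOne (u r) (v r) - Y.lactL b) w)]
    simp only [sub_apply, sum_apply, map_sub, map_sum, hrank, hlact, leftCLM_apply]
  have hadj : ∀ {R : Type u} [NonUnitalCStarAlgebra R] (V : Corr R) {M : ℕ} (u v : Fin M → V.X)
      (b : R) (p q : V.X),
      V.inner ((∑ r, V.rankOne (v r) (u r) - V.lactL (star b)) p) q =
        V.inner p ((∑ r, V.rankOne (u r) (v r) - V.lactL b) q) := by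
    intro R _ V M u v b p q
    have hi := V.isIp
    rw [← V.inner_star, ← hi.rightCLM_apply q, ← hi.rightCLM_apply p]
    simp only [sub_apply, sum_apply, map_sub, map_sum, star_sub, star_sum]
    simp only [V.rankOne_apply, hi.rightCLM_apply, V.inner_ract_right, star_mul, V.inner_star]
    rw [V.lact_adjoint, star_star]
  have hlim : Tendsto (fun n => ∑ r, Z.rankOne (ξ (x n r)) (ξ (y n r))) atTop
      (𝓝 (Z.lactL (πA a))) := by
    have h0 : Tendsto (fun n => 8 * ‖∑ r, Y.rankOne (x n r) (y n r) - Y.lactL a‖) atTop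
        (𝓝 0) := by
      simpa using (tendsto_iff_norm_sub_tendsto_zero.1 hxy).const_mul 8
    refine tendsto_iff_norm_sub_tendsto_zero.2
      (squeeze_zero (fun n => norm_nonneg _) (fun n => ?_) h0)
    exact h.norm_le_of_intertwines hπ _ (∑ r, Y.rankOne (y n r) (x n r) - Y.lactL (star a)) _
      (∑ r, Z.rankOne (ξ (y n r)) (ξ (x n r)) - Z.lactL (πA (star a)))
      (hadj Y (x n) (y n) a)
      (by
        rw [hπ.map_star]
        exact hadj Z (fun r => ξ (x n r)) (fun r => ξ (y n r)) (πA a))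
      (hsum (x n) (y n) a) (hsum (y n) (x n) (star a))
  refine (isClosed_clspan _).mem_of_tendsto (C.covariant _ N (fun n r => ξ (x n r))
    (fun n r => ξ (y n r)) hlim) (Eventually.of_forall fun n => ?_)
  exact Submodule.sum_mem _ fun r _ => subset_clspan _ ⟨_, _, rfl⟩

end MixedMod

/-! ### The two Cuntz-Pimsner algebras -/

theorem eq_of_forall_mul_right {π : A → B} (hπ : IsStarHom π) {u v : B}
    (hu : u ∈ clspan {d | ∃ c a, d = c * π a}) (hv : v ∈ clspan {d | ∃ c a, d = c * π a})
    (h : ∀ a, u * π a = v * π a) : u = v := by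
  refine sub_eq_zero.1 ((CStarRing.mul_star_self_eq_zero_iff _).1 ?_)
  refine map_mem_of_mem_clspan (mulR (star (u - v))) (K := ⊥) isClosed_singleton ?_
    (sub_mem hu hv)
  rintro _ ⟨c, a, rfl⟩
  have h0 : π a * star (u - v) = 0 := by
    rw [← star_star (π a * star (u - v)), star_mul, star_star, ← hπ.map_star, sub_mul, h, sub_self,
      star_zero]
  rw [mulR_apply, mul_assoc, h0, mul_zero]
  exact Submodule.zero_mem _

theorem IsRep.mem_clspan_mul_pi {W : Corr A} {π : A → B} {t : W.X → B} (h : IsRep W π t)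
    (x : W.X) : t x ∈ clspan {d | ∃ c a, d = c * π a} := by
  refine map_mem_of_mem_clspan h.toCLM (isClosed_clspan _) ?_ (W.mem_clspan_ract x)
  rintro _ ⟨a, rfl⟩
  rw [IsRep.toCLM_apply, h.ract]
  exact subset_clspan _ ⟨_, _, rfl⟩

theorem mul_mem_clspan_mul_pi {R : Type*} {π : R → B} {d : B} (hd : d ∈ clspan {d | ∃ c a, d = c * π a})
    (e : B) : e * d ∈ clspan {d | ∃ c a, d = c * π a} := by
  refine map_mem_of_mem_clspan (mulL e) (isClosed_clspan _) ?_ hd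
  rintro _ ⟨c, a, rfl⟩
  exact subset_clspan _ ⟨e * c, a, by simp [mul_assoc]⟩

section Restrict

variable {n : ℕ} {G : GenSys A n} {m : ℕ} {hm : m ≤ n} {hm1 : m + 1 ≤ n}

theorem GenRep.restrict {π : A → B} {σ : ∀ i, ((G.restrict (m + 1) hm1).Y i).X → B}
    (h : GenRep (G.restrict (m + 1) hm1) π σ) :
    GenRep (G.restrict m hm) π (fun i => σ i.castSucc) where
  hom := h.hom
  isRep i := h.isRep i.castSucc
  flips i j := h.flips i.castSucc j.castSucc

theorem GenRep.extend {π : A → B} {σ : ∀ i, ((G.restrict m hm).Y i).X → B}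
    {κ : (G.Y ⟨m, hm1⟩).X → B} (h : GenRep (G.restrict m hm) π σ)
    (hκ : IsRep (G.Y ⟨m, hm1⟩) π κ)
    (hflip : ∀ i : Fin m, ∃ τ : (G.T ⟨m, hm1⟩ (Fin.castLE hm i)).X →L[ℂ] B,
      (∀ y x, τ (G.tmul ⟨m, hm1⟩ (Fin.castLE hm i) y x) = κ y * σ i x) ∧
      ∀ x y, τ ((G.θ (Fin.castLE hm i) ⟨m, hm1⟩).toFun (G.tmul (Fin.castLE hm i) ⟨m, hm1⟩ x y)) =
        σ i x * κ y) :
    ∃ σ' : ∀ i, ((G.restrict (m + 1) hm1).Y i).X → B,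
      GenRep (G.restrict (m + 1) hm1) π σ' ∧ (∀ i, σ' i.castSucc = σ i) ∧
        σ' (Fin.last m) = κ := by
  let σ' : ∀ i, ((G.restrict (m + 1) hm1).Y i).X → B :=
    Fin.snoc (α := fun i => ((G.restrict (m + 1) hm1).Y i).X → B) σ κ
  have h1 : ∀ i, σ' i.castSucc = σ i := fun i => Fin.snoc_castSucc ..
  have h2 : σ' (Fin.last m) = κ := Fin.snoc_last ..
  refine ⟨σ', GenRep.of_lt h.hom (fun i => ?_) fun i j hij => ?_, h1, h2⟩
  · refine Fin.lastCases ?_ (fun i => ?_) i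
    · rw [h2]; exact hκ
    · rw [h1]; exact h.isRep i
  · induction i using Fin.lastCases with
    | last => exact absurd hij (Fin.le_last j).not_gt
    | cast i =>
      unfold Flips
      induction j using Fin.lastCases with
      | last =>
        rw [h1, h2]
        exact hflip i
      | cast j =>
        rw [h1, h1]
        exact h.flips i j

end Restrict

theorem GenRep.comp {k : ℕ} {G : GenSys A k} {B' : Type u} [NonUnitalCStarAlgebra B']
    {π : A → B} {σ : ∀ i, (G.Y i).X → B} (h : GenRep G π σ) (f : B →⋆ₙₐ[ℂ] B') :
    GenRep G (fun a => f (π a)) (fun i x => f (σ i x)) where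
  hom := isStarHom_comp f h.hom
  isRep i := ⟨isStarHom_comp f h.hom, fun x y => by rw [(h.isRep i).t_add, map_add],
    fun c x => by rw [(h.isRep i).t_smul, map_smul],
    fun a x => by rw [(h.isRep i).lact, map_mul], fun x a => by rw [(h.isRep i).ract, map_mul],
    fun x y => by rw [← map_star, ← map_mul, (h.isRep i).inner]⟩
  flips i j := by
    obtain ⟨τ, h1, h2⟩ := h.flips i j
    exact ⟨(homCLM f).comp τ, fun y x => by simp [h1], fun x y => by simp [h2]⟩

section Universal

variable {n : ℕ} {G : GenSys A n} {m : ℕ} {hm : m ≤ n} {Xs' : PSys A m}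
  {gen' : Generates (G.restrict m hm) Xs'} {C' : PSCPAlg Xs'} {p : Fin n} {Z : Corr C'.O}
  {mm : (G.Y p).X → C'.O → Z.X}

/-- The generators of `𝒪(Z)` coming from `Z = Y p ⊗ 𝒪`, together with the flips they satisfy. -/
theorem EPCorr.exists_generator (hZ : EPCorr G hm Xs' gen' C' p Z mm) (CZ : CPAlg Z) :
    ∃ ξ : (G.Y p).X →L[ℂ] Z.X, (∀ x S, Z.ract (ξ x) S = mm x S) ∧
      IsRep (G.Y p) (fun a => CZ.π (C'.rep.π a)) (fun x => CZ.t (ξ x)) ∧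
      (∀ a, CZ.π (C'.rep.π a) ∈ clspan {b | ∃ x c, b = CZ.t (ξ x) * c}) ∧
      (∀ x S, CZ.t (mm x S) = CZ.t (ξ x) * CZ.π S) ∧
      ∀ i : Fin m, ∃ τ : (G.T p (Fin.castLE hm i)).X →L[ℂ] CZ.O,
        (∀ y x, τ (G.tmul p (Fin.castLE hm i) y x) =
          CZ.t (ξ y) * CZ.π (C'.rep.ψ (egen i) ((gen'.ι i).toFun x))) ∧
        ∀ x y, τ ((G.θ (Fin.castLE hm i) p).toFun (G.tmul (Fin.castLE hm i) p x y)) =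
          CZ.π (C'.rep.ψ (egen i) ((gen'.ι i).toFun x)) * CZ.t (ξ y) := by
  have hπ : IsStarHom C'.rep.π := (C'.rep.isRep 0).hom
  have hZπ : IsStarHom CZ.π := CZ.isRep.hom
  obtain ⟨ξ, hξ, hξr, hip⟩ := hZ.mod.exists_tensor_one hπ
  have hlact : ∀ a x, ξ ((G.Y p).lactL a x) = Z.lactL (C'.rep.π a) (ξ x) := fun a x =>
    Z.eq_of_forall_ract fun S => by rw [hξ, ← Z.lactL_ract, hξ, hZ.lact_pi]
  have hract : ∀ a x, ξ ((G.Y p).ract x a) = Z.ract (ξ x) (C'.rep.π a) := fun a x => by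
    rw [hξr, hξ]
  have hmm : ∀ x S, CZ.t (mm x S) = CZ.t (ξ x) * CZ.π S := fun x S => by
    rw [← hξ, CZ.isRep.ract]
  have hrep : IsRep (G.Y p) (fun a => CZ.π (C'.rep.π a)) (fun x => CZ.t (ξ x)) :=
    { hom := ⟨fun a b => by rw [hπ.map_add, hZπ.map_add],
        fun a b => by rw [hπ.map_mul, hZπ.map_mul],
        fun a => by rw [hπ.map_star, hZπ.map_star],
        fun c a => by rw [hπ.map_smul, hZπ.map_smul]⟩
      t_add := fun x y => by rw [map_add, CZ.isRep.t_add]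
      t_smul := fun c x => by rw [map_smul, CZ.isRep.t_smul]
      lact := fun a x => by rw [hlact, CZ.isRep.lact]
      ract := fun x a => by rw [hract, CZ.isRep.ract]
      inner := fun x y => by rw [CZ.isRep.inner, hip] }
  refine ⟨ξ, hξ, hrep, hZ.mod.mem_clspan_of_regular hπ hZ.lact_pi (G.reg p).2 CZ hξ hip, hmm,
    fun i => ?_⟩
  have hψ : IsRep (G.Y (Fin.castLE hm i)) (fun a => CZ.π (C'.rep.π a))
      (fun x => CZ.π (C'.rep.ψ (egen i) ((gen'.ι i).toFun x))) :=
    ((C'.rep.genRep gen').comp hZπ.toHom).isRep i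
  obtain ⟨τ, hτ⟩ := exists_tensor_rep (G.isTensor p (Fin.castLE hm i)) hrep hψ
  refine ⟨τ, hτ, fun x y => ?_⟩
  obtain ⟨μ, hμ, hμ1, hμ2⟩ := hZ.lact_t i
  have key : ∀ S u, CZ.t (μ u S) = τ u * CZ.π S := fun S u => by
    refine eq_of_dense_span (f := CZ.isRep.toCLM.comp (hμ S).toCLM) (g := (mulR (CZ.π S)).comp τ)
      (G.isTensor p (Fin.castLE hm i)).dense ?_ u
    rintro _ ⟨y, v, rfl⟩
    change CZ.t (μ _ S) = τ _ * CZ.π S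
    rw [hμ1, hmm, hτ, hZπ.map_mul, mul_assoc]
  refine eq_of_forall_mul_right hZπ ?_
    (mul_mem_clspan_mul_pi (CZ.isRep.mem_clspan_mul_pi (ξ y)) _) fun S => ?_
  · refine mem_of_dense_span τ (G.isTensor p (Fin.castLE hm i)).dense (isClosed_clspan _) ?_ _
    rintro _ ⟨y, v, rfl⟩
    rw [hτ]
    exact subset_clspan _ ⟨_, _, rfl⟩
  · rw [← key, mul_assoc, ← hmm, ← CZ.isRep.lact]
    exact (congrArg CZ.t (hμ2 x y S)).symm

variable {hm1 : m + 1 ≤ n} {Xs : PSys A (m + 1)}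
  {gen : Generates (G.restrict (m + 1) hm1) Xs} {C : PSCPAlg Xs}

/-- The inclusion of `𝒪(Y₁ ∗ ⋯ ∗ Y_m)` into `𝒪(Y₁ ∗ ⋯ ∗ Y_{m+1})`. -/
theorem exists_base_hom (gen' : Generates (G.restrict m hm) Xs') (C' : PSCPAlg Xs')
    (gen : Generates (G.restrict (m + 1) hm1) Xs) (C : PSCPAlg Xs) :
    ∃ ρ : C'.O →⋆ₙₐ[ℂ] C.O, (∀ a, ρ (C'.rep.π a) = C.rep.π a) ∧
      ∀ (i : Fin m) (x : (G.Y (Fin.castLE hm i)).X),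
        ρ (C'.rep.ψ (egen i) ((gen'.ι i).toFun x)) =
          C.rep.ψ (egen i.castSucc) ((gen.ι i.castSucc).toFun x) :=
  exists_hom_of_genRep gen' C' (GenRep.restrict (C.rep.genRep gen))
    fun i => PSRep.mem_clspan gen C.rep C.covariant i.castSucc

variable {Zk : Corr C'.O} {mmk : (G.Y ⟨m, hm1⟩).X → C'.O → Zk.X}

theorem EPCorr.exists_equiv (hZk : EPCorr G hm Xs' gen' C' ⟨m, hm1⟩ Zk mmk) (CZ : CPAlg Zk)
    (gen : Generates (G.restrict (m + 1) hm1) Xs) (C : PSCPAlg Xs) {ρ : C'.O →⋆ₙₐ[ℂ] C.O}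
    (hρπ : ∀ a, ρ (C'.rep.π a) = C.rep.π a)
    (hρψ : ∀ (i : Fin m) (x : (G.Y (Fin.castLE hm i)).X),
      ρ (C'.rep.ψ (egen i) ((gen'.ι i).toFun x)) =
        C.rep.ψ (egen i.castSucc) ((gen.ι i.castSucc).toFun x)) :
    ∃ ι : C.O ≃⋆ₐ[ℂ] CZ.O, (∀ a, ι (C.rep.π a) = CZ.π (C'.rep.π a)) ∧
      (∀ S, ι.symm (CZ.π S) = ρ S) ∧
      (∀ x S, ι.symm (CZ.t (mmk x S)) =
        C.rep.ψ (egen (Fin.last m)) ((gen.ι (Fin.last m)).toFun x) * ρ S) ∧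
      (∀ (i : Fin m) (x : (G.Y (Fin.castLE hm i)).X),
        ι (C.rep.ψ (egen i.castSucc) ((gen.ι i.castSucc).toFun x)) =
          CZ.π (C'.rep.ψ (egen i) ((gen'.ι i).toFun x))) ∧
      ∀ (x : (G.Y ⟨m, hm1⟩).X) (ξ : Zk.X), (∀ S, Zk.ract ξ S = mmk x S) →
        ι (C.rep.ψ (egen (Fin.last m)) ((gen.ι (Fin.last m)).toFun x)) = CZ.t ξ := by
  have hπ : IsStarHom C'.rep.π := (C'.rep.isRep 0).hom
  obtain ⟨ξ, hξ, hξrep, hξd, hmm, hflip⟩ := hZk.exists_generator CZ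
  have hgr := C.rep.genRep gen
  have hd := PSRep.mem_clspan gen C.rep C.covariant
  have hκ : IsRep (G.Y ⟨m, hm1⟩) (fun a => ρ (C'.rep.π a))
      (fun x => C.rep.ψ (egen (Fin.last m)) ((gen.ι (Fin.last m)).toFun x)) := by
    simp only [hρπ]
    exact hgr.isRep (Fin.last m)
  obtain ⟨t, ht, htc, htm⟩ := hZk.exists_isRep ρ hκ (fun d => by
    refine clspan_le (isClosed_clspan _) ?_ (C.mem_clspan_pi_mul d)
    rintro _ ⟨a, c, rfl⟩
    refine map_mem_of_mem_clspan (mulR c) (isClosed_clspan _) ?_ (hd (Fin.last m) a)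
    rintro _ ⟨x, e, rfl⟩
    rw [mulR_apply, mul_assoc]
    exact subset_clspan _ ⟨x, _, rfl⟩) (fun i => by
    obtain ⟨τ, h1, h2⟩ := hgr.flips i.castSucc (Fin.last m)
    exact ⟨τ, fun y x => by rw [hρψ]; exact h1 y x, fun x y => by rw [hρψ]; exact h2 x y⟩)
  obtain ⟨h2, ⟨h2π, h2t⟩, -⟩ := CZ.universal C.O ρ t ht htc
  obtain ⟨σ', hσ', hσ1, hσ2⟩ := GenRep.extend (hm1 := hm1)
    ((C'.rep.genRep gen').comp CZ.isRep.hom.toHom) hξrep hflip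
  obtain ⟨h1, h1π, h1σ⟩ := exists_hom_of_genRep gen C hσ' (fun i a => by
    induction i using Fin.lastCases with
    | last => rw [hσ2]; exact hξd a
    | cast i =>
      rw [hσ1]
      refine map_mem_of_mem_clspan CZ.isRep.hom.toCLM (isClosed_clspan _) ?_
        (PSRep.mem_clspan gen' C'.rep C'.covariant i a)
      rintro _ ⟨x, c, rfl⟩
      exact subset_clspan _ ⟨x, CZ.π c, CZ.isRep.hom.map_mul _ _⟩)
  have h1cast : ∀ (i : Fin m) (x : (G.Y (Fin.castLE hm i)).X),
      h1 (C.rep.ψ (egen i.castSucc) ((gen.ι i.castSucc).toFun x)) =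
        CZ.π (C'.rep.ψ (egen i) ((gen'.ι i).toFun x)) := fun i x =>
    (h1σ i.castSucc x).trans (congrFun (hσ1 i) x)
  have h1last : ∀ x : (G.Y ⟨m, hm1⟩).X,
      h1 (C.rep.ψ (egen (Fin.last m)) ((gen.ι (Fin.last m)).toFun x)) = CZ.t (ξ x) := fun x =>
    (h1σ (Fin.last m) x).trans (congrFun hσ2 x)
  have h2ξ : ∀ x, h2 (CZ.t (ξ x)) =
      C.rep.ψ (egen (Fin.last m)) ((gen.ι (Fin.last m)).toFun x) := by
    intro x
    rw [h2t]
    refine eqOn_clspan (f := t.comp ξ) (g := hκ.toCLM) ?_ ((G.Y ⟨m, hm1⟩).mem_clspan_ract x)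
    rintro _ ⟨a, rfl⟩
    have := htm x (C'.rep.π a)
    rw [← hξ, ← hκ.ract] at this
    rw [ContinuousLinearMap.comp_apply, IsRep.toCLM_apply, ← this]
    congr 1
    refine Zk.eq_of_forall_ract fun S => ?_
    rw [hξ, hZk.mod.balanced, ← Zk.ract_mul, hξ]
  have h12 : ∀ S, h1 (ρ S) = CZ.π S := fun S =>
    PSCPAlg.hom_ext gen' C' (f := h1.comp ρ) (g := CZ.isRep.hom.toHom)
      (fun a => by
        change h1 (ρ _) = CZ.π _
        rw [hρπ, h1π]
        rfl)
      (fun i x => by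
        change h1 (ρ _) = CZ.π _
        exact (congrArg h1 (hρψ i x)).trans (h1cast i x)) S
  have left : ∀ z, h2 (h1 z) = z := fun z =>
    PSCPAlg.hom_ext gen C (f := h2.comp h1) (g := NonUnitalStarAlgHom.id ℂ C.O)
      (fun a => by
        change h2 (h1 _) = _
        rw [h1π]
        exact (h2π _).trans (hρπ a))
      (fun i x => by
        change h2 (h1 _) = C.rep.ψ (egen i) ((gen.ι i).toFun x)
        induction i using Fin.lastCases with
        | last => exact (congrArg h2 (h1last x)).trans (h2ξ x)
        | cast i => exact (congrArg h2 (h1cast i x)).trans ((h2π _).trans (hρψ i x))) z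
  have right : ∀ z, h1 (h2 z) = z := fun z =>
    CPAlg.hom_ext CZ (f := h1.comp h2) (g := NonUnitalStarAlgHom.id ℂ CZ.O)
      (fun S => by
        change h1 (h2 _) = _
        rw [h2π, h12]
        rfl)
      (fun z => by
        refine eq_of_dense_span (f := ((homCLM h1).comp (homCLM h2)).comp CZ.isRep.toCLM)
          (g := CZ.isRep.toCLM) hZk.mod.dense ?_ z
        rintro _ ⟨x, S, rfl⟩
        change h1 (h2 (CZ.t _)) = CZ.t _
        rw [h2t, htm, map_mul, h1last, h12, hmm]) z
  let ι : C.O ≃⋆ₐ[ℂ] CZ.O := StarAlgEquiv.ofBijective h1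
    ⟨Function.LeftInverse.injective left, Function.RightInverse.surjective right⟩
  have hsymm : ∀ z, ι.symm z = h2 z := fun z => by
    rw [← right z, left]
    exact ι.symm_apply_apply _
  refine ⟨ι, fun a => h1π a, fun S => (hsymm _).trans (h2π S), fun x S => ?_, h1cast, ?_⟩
  · rw [hsymm, h2t, htm]
  · intro x ξ' hξ'
    rw [Zk.eq_of_forall_ract fun S => (hξ' S).trans (hξ x S).symm]
    exact h1last x

end Universal

/-! ### The isomorphism of bimodules -/

theorem MixedMod.exists_induced_map {O : Type u} [NonUnitalCStarAlgebra O] {OZ : Type u}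
    [NonUnitalCStarAlgebra OZ] {OC : Type u} [NonUnitalCStarAlgebra OC] {Y : Corr A} {Zj : Corr O}
    {W : Corr OZ} {V : Corr OC} {πO : A → O} {πZ : O → OZ} {πC : A → OC} {mmj : Y.X → O → Zj.X}
    {mW : Zj.X → OZ → W.X} {mmV : Y.X → OC → V.X} (hZ : MixedMod Y O πO Zj mmj)
    (hπZ : IsStarHom πZ) (hπC : IsStarHom πC)
    (hW : MixedMod Zj OZ πZ W mW) (hV : MixedMod Y OC πC V mmV) (h : OZ ≃⋆ₐ[ℂ] OC)
    {ρ : O →⋆ₙₐ[ℂ] OC} (hρ : ∀ S, h (πZ S) = ρ S) (hρπ : ∀ a, ρ (πO a) = πC a)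
    (hC : ∀ z, z ∈ clspan {b | ∃ a c, b = πC a * c}) :
    ∃ φ : W.X →L[ℂ] V.X, Function.Bijective φ ∧
      (∀ x S T, φ (mW (mmj x S) T) = mmV x (ρ S * h T)) ∧
      (∀ u v, V.inner (φ u) (φ v) = h (W.inner u v)) ∧
      ∀ w T, φ (W.ract w T) = V.ract (φ w) (h T) := by
  let hh : OZ →⋆ₙₐ[ℂ] OC := h
  have hdense : closure (Submodule.span ℂ (Set.range fun q : (Y.X × O) × OZ =>
      mW (mmj q.1.1 q.1.2) q.2) : Set W.X) = Set.univ := by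
    refine Set.eq_univ_of_forall fun w => ?_
    refine mem_of_dense_span (ContinuousLinearMap.id ℂ W.X) hW.dense (isClosed_clspan _) ?_ w
    rintro _ ⟨ζ, T, rfl⟩
    refine mem_of_dense_span (hW.leftCLM hπZ T) hZ.dense (isClosed_clspan _) ?_ ζ
    rintro _ ⟨x, S, rfl⟩
    exact subset_clspan _ ⟨((x, S), T), rfl⟩
  obtain ⟨φ, hφ, hip⟩ := W.isIp.exists_clm V.isIp (homCLM hh)
    (fun q : (Y.X × O) × OZ => mW (mmj q.1.1 q.1.2) q.2)
    (fun q => mmV q.1.1 (ρ q.1.2 * h q.2)) hdense (fun p q => by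
      rw [hV.inner, hW.inner, hZ.inner]
      change _ = h _
      simp only [map_mul, map_star, hρ, hρπ, star_mul, mul_assoc])
  have hφ' : ∀ x S T, φ (mW (mmj x S) T) = mmV x (ρ S * h T) := fun x S T => hφ ((x, S), T)
  have hnorm : ∀ u, ‖φ u‖ = ‖u‖ := fun u => by
    rw [← sq_eq_sq₀ (norm_nonneg _) (norm_nonneg _), V.norm_eq, W.norm_eq, hip]
    exact NonUnitalStarAlgHom.norm_map hh h.injective _
  have hiso : Isometry φ := AddMonoidHomClass.isometry_of_norm φ hnorm
  refine ⟨φ, ⟨hiso.injective, fun v => ?_⟩, hφ', hip, fun w T => ?_⟩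
  · refine mem_of_dense_span (ContinuousLinearMap.id ℂ V.X)
      (K := LinearMap.range (φ : W.X →ₗ[ℂ] V.X)) hV.dense hiso.isClosedEmbedding.isClosed_range ?_ v
    rintro _ ⟨x, R, rfl⟩
    refine map_mem_of_mem_clspan (hV.rightCLM hπC x) hiso.isClosedEmbedding.isClosed_range ?_ (hC R)
    rintro _ ⟨a, c, rfl⟩
    refine ⟨mW (mmj x (πO a)) (h.symm c), ?_⟩
    change φ _ = mmV x _
    rw [hφ', hρπ, h.apply_symm_apply]
  · refine eq_of_dense_span (f := φ.comp (W.ractCLM T)) (g := (V.ractCLM (h T)).comp φ) hdense ?_ w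
    rintro _ ⟨⟨⟨x, S⟩, R⟩, rfl⟩
    simp only [ContinuousLinearMap.comp_apply, Corr.ractCLM_apply]
    rw [hW.ract, hφ', hφ', hV.ract, map_mul, mul_assoc]

namespace MixedPair

variable {O : Type u} [NonUnitalCStarAlgebra O] {πA : A → O} {Y : Corr A} {V P : Corr O}
  {p : Y.X → V.X → P.X}

theorem norm_le (h : MixedPair Y πA V P p) (hπ : IsStarHom πA) (x : Y.X) (v : V.X) :
    ‖p x v‖ ≤ 4 * ‖x‖ * ‖v‖ := by
  refine le_of_sq_le_sq ?_ (by positivity)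
  rw [P.norm_eq, h.inner]
  calc _ ≤ 4 * ‖v‖ * ‖V.lactL (πA (Y.inner x x)) v‖ := V.isIp.norm_le _ _
    _ ≤ 4 * ‖v‖ * (4 * ‖v‖ * ‖πA (Y.inner x x)‖) := by gcongr; exact V.norm_lactL_apply_le _ _
    _ ≤ 4 * ‖v‖ * (4 * ‖v‖ * ‖x‖ ^ 2) := by
      rw [Y.norm_eq]
      gcongr
      exact hπ.norm_le _
    _ = _ := by ring

/-- `v ↦ x ⊗ v` as a continuous linear map. -/
def rightCLM (h : MixedPair Y πA V P p) (hπ : IsStarHom πA) (x : Y.X) : V.X →L[ℂ] P.X :=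
  LinearMap.mkContinuous
    { toFun := p x
      map_add' := h.add_right x
      map_smul' := fun c v => h.smul_right c x v } (4 * ‖x‖) (h.norm_le hπ x)

@[simp] theorem rightCLM_apply (h : MixedPair Y πA V P p) (hπ : IsStarHom πA) (x : Y.X)
    (v : V.X) : h.rightCLM hπ x v = p x v := rfl

/-- `x ↦ x ⊗ v` as a continuous linear map. -/
def leftCLM (h : MixedPair Y πA V P p) (hπ : IsStarHom πA) (v : V.X) : Y.X →L[ℂ] P.X :=
  LinearMap.mkContinuous
    { toFun := fun x => p x v
      map_add' := fun x y => h.add_left x y v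
      map_smul' := fun c x => h.smul_left c x v } (4 * ‖v‖)
    (fun x => (h.norm_le hπ x v).trans (by nlinarith))

@[simp] theorem leftCLM_apply (h : MixedPair Y πA V P p) (hπ : IsStarHom πA) (x : Y.X)
    (v : V.X) : h.leftCLM hπ v x = p x v := rfl

end MixedPair

theorem IsTensor.mixedPair {W V T : Corr A} {m : W.X → V.X → T.X} (h : IsTensor W V T m) :
    MixedPair W (fun a : A => a) V T m :=
  ⟨h.add_left, h.add_right, h.smul_left, h.smul_right, h.balanced, h.inner, h.ract, h.lact,
    h.dense⟩

theorem isStarHom_id : IsStarHom fun a : A => a :=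
  ⟨fun _ _ => rfl, fun _ _ => rfl, fun _ => rfl, fun _ _ => rfl⟩

section Intertwine

variable {n : ℕ} {G : GenSys A n} {m : ℕ} {hm : m ≤ n} {Xs' : PSys A m}
  {gen' : Generates (G.restrict m hm) Xs'} {C' : PSCPAlg Xs'} {hm1 : m + 1 ≤ n}
  {Xs : PSys A (m + 1)} {gen : Generates (G.restrict (m + 1) hm1) Xs} {C : PSCPAlg Xs}
  {j : Fin n} {Zj : Corr C'.O} {mmj : (G.Y j).X → C'.O → Zj.X} {Vj : Corr C.O}
  {mmVj : (G.Y j).X → C.O → Vj.X}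

theorem EPCorr.intertwines_pi (hZj : EPCorr G hm Xs' gen' C' j Zj mmj)
    (hVj : EPCorr G hm1 Xs gen C j Vj mmVj) {OZ : Type u} [NonUnitalCStarAlgebra OZ]
    {πZ : C'.O → OZ} (hπZ : IsStarHom πZ) {W : Corr OZ} {mW : Zj.X → OZ → W.X}
    (hW : MixedMod Zj OZ πZ W mW)
    (hWπ : ∀ S y T, W.lactL (πZ S) (mW y T) = mW (Zj.lactL S y) T)
    {h : OZ ≃⋆ₐ[ℂ] C.O} {ρ : C'.O →⋆ₙₐ[ℂ] C.O} (hρ : ∀ S, h (πZ S) = ρ S)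
    (hρπ : ∀ a, ρ (C'.rep.π a) = C.rep.π a)
    (hρψ : ∀ (i : Fin m) (x : (G.Y (Fin.castLE hm i)).X),
      ρ (C'.rep.ψ (egen i) ((gen'.ι i).toFun x)) =
        C.rep.ψ (egen i.castSucc) ((gen.ι i.castSucc).toFun x))
    {φ : W.X →L[ℂ] Vj.X} (hφ : ∀ x S T, φ (mW (mmj x S) T) = mmVj x (ρ S * h T))
    {K : NonUnitalStarSubalgebra ℂ OZ} (hK : IsClosed (K : Set OZ))
    (hmem : ∀ b, b ∈ K ↔ ∀ w, φ (W.lactL b w) = Vj.lactL (h b) (φ w)) (S : C'.O) : πZ S ∈ K := by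
  have hπC : IsStarHom C.rep.π := (C.rep.isRep 0).hom
  have ext : ∀ S, (∀ y R T, φ (mW (Zj.lactL S (mmj y R)) T) =
      Vj.lactL (ρ S) (mmVj y (ρ R * h T))) → πZ S ∈ K := fun S hS => (hmem _).2 fun w => by
    refine eq_of_dense_span (f := φ.comp (W.lactL _)) (g := (Vj.lactL _).comp φ) hW.dense ?_ w
    rintro _ ⟨ζ, T, rfl⟩
    rw [ContinuousLinearMap.comp_apply, hWπ, ContinuousLinearMap.comp_apply, hρ]
    refine eq_of_dense_span (f := (φ.comp (hW.leftCLM hπZ T)).comp (Zj.lactL S))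
      (g := ((Vj.lactL _).comp φ).comp (hW.leftCLM hπZ T)) hZj.mod.dense ?_ ζ
    rintro _ ⟨y, R, rfl⟩
    simp only [ContinuousLinearMap.comp_apply, MixedMod.leftCLM_apply]
    rw [hS, hφ]
  refine C'.mem_of_generators gen' (K.comap hπZ.toHom)
    (hK.preimage (homCLM hπZ.toHom).continuous) (fun a => ext _ fun y R T => ?_)
    (fun i x => ext _ fun y R T => ?_) S
  · rw [hZj.lact_pi, hφ, hρπ, hVj.lact_pi]
  · obtain ⟨μ, hμ, hμ1, hμ2⟩ := hZj.lact_t i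
    obtain ⟨ν, hν, hν1, hν2⟩ := hVj.lact_t i.castSucc
    have key : ∀ u, φ (mW (μ u R) T) = ν u (ρ R * h T) := fun u => by
      refine eq_of_dense_span (f := (φ.comp (hW.leftCLM hπZ T)).comp (hμ R).toCLM)
        (g := (hν (ρ R * h T)).toCLM) (G.isTensor j (Fin.castLE hm i)).dense ?_ u
      rintro _ ⟨y, v, rfl⟩
      change φ (mW (μ _ R) T) = ν (G.tmul j (Fin.castLE hm i) y v) (ρ R * h T)
      rw [hμ1, hφ, map_mul, mul_assoc, hρψ]
      exact (hν1 y v _).symm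
    refine (congrArg (fun ζ => φ (mW ζ T)) (hμ2 x y R)).trans ((key _).trans ?_)
    refine (hν2 x y _).symm.trans ?_
    exact congrArg (fun b => Vj.lactL b (mmVj y (ρ R * h T))) (hρψ i x).symm

variable {Zk : Corr C'.O} {mmk : (G.Y ⟨m, hm1⟩).X → C'.O → Zk.X}

theorem EPCorr.intertwines_t (hZk : EPCorr G hm Xs' gen' C' ⟨m, hm1⟩ Zk mmk) {CZ : CPAlg Zk}
    (hZj : EPCorr G hm Xs' gen' C' j Zj mmj) (hVj : EPCorr G hm1 Xs gen C j Vj mmVj)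
    {TZkj TZjk : Corr C'.O} {mZkj : Zk.X → Zj.X → TZkj.X} {mZjk : Zj.X → Zk.X → TZjk.X}
    (hTZjk : IsTensor Zj Zk TZjk mZjk) {θZ : TZkj.X → TZjk.X}
    (D : RTheta C'.O C'.rep.π (G.Y ⟨m, hm1⟩) (G.Y j) (G.T ⟨m, hm1⟩ j) (G.T j ⟨m, hm1⟩)
      (G.tmul ⟨m, hm1⟩ j) (G.tmul j ⟨m, hm1⟩) ((G.θ ⟨m, hm1⟩ j).toFun) Zk Zj mmk mmj
      TZkj TZjk mZkj mZjk θZ)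
    {W : Corr CZ.O} {mW : Zj.X → CZ.O → W.X}
    (hW : ECorrData Zk Zj TZkj mZkj TZjk mZjk θZ CZ W mW)
    {h : CZ.O ≃⋆ₐ[ℂ] C.O} {ρ : C'.O →⋆ₙₐ[ℂ] C.O} (hρ : ∀ S, h (CZ.π S) = ρ S)
    (hρπ : ∀ a, ρ (C'.rep.π a) = C.rep.π a)
    (hht : ∀ x S, h (CZ.t (mmk x S)) =
      C.rep.ψ (egen (Fin.last m)) ((gen.ι (Fin.last m)).toFun x) * ρ S)
    {φ : W.X →L[ℂ] Vj.X} (hφ : ∀ x S T, φ (mW (mmj x S) T) = mmVj x (ρ S * h T))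
    (hφπ : ∀ S w, φ (W.lactL (CZ.π S) w) = Vj.lactL (ρ S) (φ w))
    (x : (G.Y ⟨m, hm1⟩).X) (S : C'.O) (w : W.X) :
    φ (W.lactL (CZ.t (mmk x S)) w) = Vj.lactL (h (CZ.t (mmk x S))) (φ w) := by
  have hπ : IsStarHom C'.rep.π := (C'.rep.isRep 0).hom
  have hπC : IsStarHom C.rep.π := (C.rep.isRep 0).hom
  have hπZ := CZ.isRep.hom
  have hκ : IsRep (G.Y ⟨m, hm1⟩) C.rep.π
      (fun x => C.rep.ψ (egen (Fin.last m)) ((gen.ι (Fin.last m)).toFun x)) :=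
    (C.rep.genRep gen).isRep (Fin.last m)
  set κ : (G.Y ⟨m, hm1⟩).X → C.O :=
    fun x => C.rep.ψ (egen (Fin.last m)) ((gen.ι (Fin.last m)).toFun x)
  replace hht : ∀ x S, h (CZ.t (mmk x S)) = κ x * ρ S := hht
  have hT := G.isTensor j ⟨m, hm1⟩
  obtain ⟨μV, hμV, hμV1, hμV2⟩ : ∃ μ : (G.T j ⟨m, hm1⟩).X → C.O → Vj.X,
      (∀ R, IsCLMap fun u => μ u R) ∧ (∀ y u R, μ (G.tmul j ⟨m, hm1⟩ y u) R = mmVj y (κ u * R)) ∧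
      ∀ x y R, Vj.lactL (κ x) (mmVj y R) =
        μ ((G.θ ⟨m, hm1⟩ j).toFun (G.tmul ⟨m, hm1⟩ j x y)) R := hVj.lact_t (Fin.last m)
  obtain ⟨μ, hμ, hμ1, hμ2⟩ := hW.lact_t
  let tC : Zk.X →L[ℂ] C.O := (homCLM (h : CZ.O →⋆ₙₐ[ℂ] C.O)).comp CZ.isRep.toCLM
  have htC : ∀ ζ, tC ζ = h (CZ.t ζ) := fun _ => rfl
  refine eq_of_dense_span (f := φ.comp (W.lactL _)) (g := (Vj.lactL _).comp φ) hW.mod.dense ?_ w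
  rintro _ ⟨ζ, T, rfl⟩
  rw [ContinuousLinearMap.comp_apply, ContinuousLinearMap.comp_apply]
  -- the bounded operator `Pr → Vj` sending `y ⊗ ζ` to `y ⊗ h (t ζ) (h T)`
  have hdense : closure (Submodule.span ℂ (Set.range
      fun q : ((G.Y j).X × (G.Y ⟨m, hm1⟩).X) × C'.O => D.pji q.1.1 (mmk q.1.2 q.2)) :
      Set D.Pr.X) = Set.univ := by
    refine Set.eq_univ_of_forall fun z => ?_
    refine mem_of_dense_span (ContinuousLinearMap.id ℂ D.Pr.X) D.hqr.dense (isClosed_clspan _) ?_ z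
    rintro _ ⟨u, R, rfl⟩
    refine mem_of_dense_span (D.hqr.leftCLM hπ R) hT.dense (isClosed_clspan _) ?_ u
    rintro _ ⟨y, v, rfl⟩
    rw [MixedMod.leftCLM_apply, D.q_compatr]
    exact subset_clspan _ ⟨((y, v), R), rfl⟩
  obtain ⟨M, hM, -⟩ := D.Pr.isIp.exists_clm Vj.isIp
    (((mulL (star (h T))).comp (mulR (h T))).comp (homCLM ρ))
    (fun q : ((G.Y j).X × (G.Y ⟨m, hm1⟩).X) × C'.O => D.pji q.1.1 (mmk q.1.2 q.2))
    (fun q => mmVj q.1.1 (κ q.1.2 * ρ q.2 * h T)) hdense (fun q q' => by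
      rw [D.hpr.inner, hVj.mod.inner, hZk.lact_pi, hZk.mod.inner]
      simp only [ContinuousLinearMap.comp_apply, mulL_apply, mulR_apply, homCLM_apply, map_mul,
        map_star, star_mul, hρπ, ← hκ.inner, hκ.lact, mul_assoc])
  replace hM : ∀ y v R, M (D.pji y (mmk v R)) = mmVj y (κ v * ρ R * h T) :=
    fun y v R => hM ((y, v), R)
  have hM1 : ∀ y ζ, M (D.pji y ζ) = mmVj y (h (CZ.t ζ) * h T) := fun y ζ => by
    refine eq_of_dense_span (f := M.comp (D.hpr.rightCLM hπ y))
      (g := ((hVj.mod.rightCLM hπC y).comp (mulR (h T))).comp tC) hZk.mod.dense ?_ ζ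
    rintro _ ⟨v, R, rfl⟩
    simp only [ContinuousLinearMap.comp_apply, MixedPair.rightCLM_apply, MixedMod.rightCLM_apply,
      mulR_apply, htC]
    rw [hM, hht]
  have hM2 : ∀ u R, M (D.qr u R) = μV u (ρ R * h T) := fun u R => by
    refine eq_of_dense_span (f := M.comp (D.hqr.leftCLM hπ R)) (g := (hμV (ρ R * h T)).toCLM)
      hT.dense ?_ u
    rintro _ ⟨y, v, rfl⟩
    change M (D.qr _ R) = μV _ _
    rw [D.q_compatr, hM, hμV1, mul_assoc]
  have hN : ∀ u, φ (μ u T) = M (D.νr u) := fun u => by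
    refine eq_of_dense_span (f := φ.comp (hμ T).toCLM) (g := M.comp D.hνr.1.toCLM) hTZjk.dense ?_ u
    rintro _ ⟨y, ζ, rfl⟩
    refine eq_of_dense_span
      (f := (φ.comp (hμ T).toCLM).comp (hTZjk.mixedPair.leftCLM isStarHom_id ζ))
      (g := (M.comp D.hνr.1.toCLM).comp (hTZjk.mixedPair.leftCLM isStarHom_id ζ))
      hZj.mod.dense ?_ y
    rintro _ ⟨y, R, rfl⟩
    change φ (μ (mZjk _ ζ) T) = M (D.νr (mZjk _ ζ))
    rw [hμ1, hφ, D.hνr.2.2, hM1, CZ.isRep.lact, map_mul, map_mul, hρ, mul_assoc]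
  have hΘ : ∀ ζ, M (D.Θ (D.pij x ζ)) = Vj.lactL (κ x) (φ (mW ζ T)) := fun ζ => by
    refine eq_of_dense_span (f := (M.comp D.hΘ.1.toCLM).comp (D.hp.rightCLM hπ x))
      (g := ((Vj.lactL (κ x)).comp φ).comp (hW.mod.leftCLM hπZ T)) hZj.mod.dense ?_ ζ
    rintro _ ⟨y, R, rfl⟩
    change M (D.Θ (D.pij x _)) = Vj.lactL (κ x) (φ (mW _ T))
    rw [← D.q_compat, D.hΘ.2, hM2, hφ, hμV2]
  rw [hμ2, hN, D.hR, D.hν.2.2, hΘ, ← hW.lact_pi, hφπ, hht, Vj.lactL_mul_apply]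

end Intertwine

/-- Proposition `Prop general iso`.  Let `(Y, θ)` be a
generating system of `n` nondegenerate regular `A`-correspondences and
`1 < k ≤ n`.  For any `j`, the
`𝒪(Y_k ⊗ 𝒪(Y₁∗⋯∗Y_{k-1}))`-correspondence
`(Y_j ⊗ 𝒪(Y₁∗⋯∗Y_{k-1})) ⊗ 𝒪(Y_k ⊗ 𝒪(Y₁∗⋯∗Y_{k-1}))` and the
`𝒪(Y₁∗⋯∗Y_k)`-correspondence `Y_j ⊗ 𝒪(Y₁∗⋯∗Y_k)` are isomorphic, via
`φ : (x ⊗ S) ⊗ T ↦ x ⊗ ι⁻¹(S T)` lying over the isomorphism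
`ι : 𝒪(Y₁∗⋯∗Y_k) ≅ 𝒪(Y_k ⊗ 𝒪(Y₁∗⋯∗Y_{k-1}))` (which satisfies
`ι ∘ ψ_{e_i} = σ_i`). -/
theorem induced_correspondence_iso
    {A : Type u} [NonUnitalCStarAlgebra A]
    {n : ℕ} (G : GenSys A n) (k : ℕ) (hk1 : 1 < k) (hkn : k ≤ n)
    (hk1n : k - 1 ≤ n)
    -- `𝒪(Y₁ ∗ ⋯ ∗ Y_{k-1})`:
    (Xs' : PSys A (k - 1))
    (gen' : Generates (G.restrict (k - 1) hk1n) Xs') (C' : PSCPAlg Xs')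
    -- `Z_k = Y_k ⊗ 𝒪(Y₁ ∗ ⋯ ∗ Y_{k-1})`:
    (Zk : Corr C'.O) (mmk : (G.Y ⟨k - 1, by omega⟩).X → C'.O → Zk.X)
    (hZk : EPCorr G hk1n Xs' gen' C' ⟨k - 1, by omega⟩ Zk mmk)
    (CZ : CPAlg Zk)
    -- `𝒪(Y₁ ∗ ⋯ ∗ Y_k)`:
    (Xs : PSys A k) (gen : Generates (G.restrict k hkn) Xs) (C : PSCPAlg Xs)
    (j : Fin n)
    -- `Z_j = Y_j ⊗ 𝒪(Y₁ ∗ ⋯ ∗ Y_{k-1})`: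
    (Zj : Corr C'.O) (mmj : (G.Y j).X → C'.O → Zj.X)
    (hZj : EPCorr G hk1n Xs' gen' C' j Zj mmj)
    -- `V_j = Y_j ⊗ 𝒪(Y₁ ∗ ⋯ ∗ Y_k)`:
    (Vj : Corr C.O) (mmVj : (G.Y j).X → C.O → Vj.X)
    (hVj : EPCorr G hkn Xs gen C j Vj mmVj)
    -- `ℛθ_{kj} : Z_k ⊗ Z_j → Z_j ⊗ Z_k`:
    (TZkj TZjk : Corr C'.O)
    (mZkj : Zk.X → Zj.X → TZkj.X) (mZjk : Zj.X → Zk.X → TZjk.X)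
    (hTZkj : IsTensor Zk Zj TZkj mZkj) (hTZjk : IsTensor Zj Zk TZjk mZjk)
    (θZ : TZkj.X → TZjk.X)
    (hθZ : Nonempty (RTheta C'.O C'.rep.π
      (G.Y ⟨k - 1, by omega⟩) (G.Y j)
      (G.T ⟨k - 1, by omega⟩ j) (G.T j ⟨k - 1, by omega⟩)
      (G.tmul ⟨k - 1, by omega⟩ j) (G.tmul j ⟨k - 1, by omega⟩)
      ((G.θ ⟨k - 1, by omega⟩ j).toFun)
      Zk Zj mmk mmj TZkj TZjk mZkj mZjk θZ))
    -- `W = Z_j ⊗_{𝒪(Y₁∗⋯∗Y_{k-1})} 𝒪(Z_k)`, with left action via `ℛθ_{kj}`: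
    (W : Corr CZ.O) (mW : Zj.X → CZ.O → W.X)
    (hW : ECorrData Zk Zj TZkj mZkj TZjk mZjk θZ CZ W mW) :
    ∃ ι : C.O ≃⋆ₐ[ℂ] CZ.O,
      -- `ι ∘ ψ_{e_i} = σ_i` for `i < k`:
      (∀ (i : Fin (k - 1)) (x : (G.Y (Fin.castLE hk1n i)).X),
        ι (C.rep.ψ (egen (Fin.castLE (by omega) i))
            ((gen.ι (Fin.castLE (by omega) i)).toFun x)) =
          CZ.π (C'.rep.ψ (egen i) ((gen'.ι i).toFun x))) ∧
      -- `ι ∘ ψ_{e_k} = σ_k`, where `σ_k(x) = t(x ⊗ 1)`: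
      (∀ (x : (G.Y ⟨k - 1, by omega⟩).X) (ξ : Zk.X),
        (∀ S, Zk.ract ξ S = mmk x S) →
        ι (C.rep.ψ (egen ⟨k - 1, by omega⟩)
            ((gen.ι ⟨k - 1, by omega⟩).toFun x)) = CZ.t ξ) ∧
      -- the bimodule isomorphism `φ : (x ⊗ S) ⊗ T ↦ x ⊗ ι⁻¹(S T)`:
      ∃ φ : CorrIsoOver (fun b => ι.symm b) W Vj,
        ∀ x S T, φ.toFun (mW (mmj x S) T) = mmVj x (ι.symm (CZ.π S * T)) := by
  obtain ⟨m, rfl⟩ : ∃ m, k = m + 1 := ⟨k - 1, by omega⟩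
  obtain ⟨ρ, hρπ, hρψ⟩ := exists_base_hom gen' C' gen C
  obtain ⟨ι, -, hισ, hιt, hιcast, hιlast⟩ := hZk.exists_equiv CZ gen C hρπ hρψ
  obtain ⟨D⟩ := hθZ
  have hπC : IsStarHom C.rep.π := (C.rep.isRep 0).hom
  obtain ⟨φ, hbij, hφ, hip, hract⟩ := hZj.mod.exists_induced_map CZ.isRep.hom hπC hW.mod hVj.mod
    ι.symm hισ hρπ C.mem_clspan_pi_mul
  obtain ⟨K, hK, hmem⟩ := exists_intertwiner_subalgebra W Vj.isIp φ (fun b => ι.symm b) hip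
    (fun b v => Vj.lactL (ι.symm b) v)
    (fun a b v => by rw [map_add, Vj.lact_add, add_apply])
    (fun a b v => by rw [map_mul, Vj.lactL_mul_apply])
    (fun c a v => by rw [map_smul, Vj.lact_smul, smul_apply])
    (fun v => (Vj.lactCLM v).continuous.comp
      (homCLM (ι.symm : CZ.O →⋆ₙₐ[ℂ] C.O)).continuous)
    (fun a u v => by rw [Vj.lact_adjoint, map_star])
    (fun d hd => Vj.isIp.eq_zero_of_self (by
      obtain ⟨w, rfl⟩ := hbij.2 d
      exact hd w))
  have hKπ : ∀ S, CZ.π S ∈ K :=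
    hZj.intertwines_pi hVj CZ.isRep.hom hW.mod hW.lact_pi hισ hρπ hρψ hφ hK hmem
  have hKt : ∀ ζ, CZ.t ζ ∈ K := fun ζ => (hmem _).2 fun w => by
    refine eq_of_dense_span
      (f := φ.comp ((W.lactCLM w).comp CZ.isRep.toCLM))
      (g := (Vj.lactCLM (φ w)).comp
        ((homCLM (ι.symm : CZ.O →⋆ₙₐ[ℂ] C.O)).comp CZ.isRep.toCLM)) hZk.mod.dense ?_ ζ
    rintro _ ⟨x, S, rfl⟩
    exact hZk.intertwines_t hZj hVj hTZjk D hW hισ hρπ hιt hφ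
      (fun S w => by rw [(hmem _).1 (hKπ S) w, hισ]) x S w
  refine ⟨ι, hιcast, hιlast, ⟨φ, hbij, map_add φ, map_smul φ, hip, hract,
    fun a w => (hmem a).1 (CZ.mem_of_generators K hK hKπ hKt a) w⟩, fun x S T => ?_⟩
  change φ _ = _
  rw [hφ, map_mul, hισ]
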